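/- arXiv:0908.0475 — 5 statements merged into one kernel-verified Lean document; each statement's English description precedes it below -/
import Mathlib

section
/- Fix an integer n ≥ 3. The class H^<_n of all finite ordered K_n-free graphs has the Ramsey property: for all X, Y ∈ H^<_n and every k ∈ ℕ there exists Z ∈ H^<_n such that for every map α from the copies of X in Z to {1,…,k} there is a copy Ỹ of Y in Z on whose copies of X the map α is constant. -/
/-- `f` is an embedding of ordered graphs (vertex sets `Fin a`, `Fin c` with their
natural linear orders): strictly increasing, preserving and reflecting adjacency. -/
def OrdEmb {a c : ℕ} (X : SimpleGraph (Fin a)) (Z : SimpleGraph (Fin c))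
    (f : Fin a → Fin c) : Prop :=
  StrictMono f ∧ ∀ i j, Z.Adj (f i) (f j) ↔ X.Adj i j

/-- `lam` is a proper coloring of `X` with colors in `Fin n`. -/
def ProperCol {a n : ℕ} (X : SimpleGraph (Fin a)) (lam : Fin a → Fin n) : Prop :=
  ∀ i j, X.Adj i j → lam i ≠ lam j

/-- `f` is an embedding of ordered `[n]`-colored graphs: an ordered-graph embedding
that also preserves the vertex colorings. -/
def ColOrdEmb {n a c : ℕ} (X : SimpleGraph (Fin a)) (lamX : Fin a → Fin n)
    (Z : SimpleGraph (Fin c)) (lamZ : Fin c → Fin n) (f : Fin a → Fin c) : Prop :=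
  OrdEmb X Z f ∧ ∀ i, lamZ (f i) = lamX i

/-- `S` is the vertex set of an induced copy of the (unordered) graph `X` in `Z`. -/
def IsCopy {a c : ℕ} (X : SimpleGraph (Fin a)) (Z : SimpleGraph (Fin c))
    (S : Finset (Fin c)) : Prop :=
  ∃ f : Fin a → Fin c, Function.Injective f ∧
    (∀ i j, Z.Adj (f i) (f j) ↔ X.Adj i j) ∧ Finset.image f Finset.univ = S

/-- If Ramsey's theorem holds for `a`-subsets, then every large finite set has a subset of size `m`
on whose `(a + 1)`-subsets the colour depends only on the minimum. -/
theorem exists_min_determined_subset {κ : Type} (a : ℕ)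
    (ih : ∀ m : ℕ, ∃ p : ℕ, ∀ (T : Type) [LinearOrder T] (S : Finset T), p ≤ S.card →
      ∀ χ : Finset T → κ, ∃ U ⊆ S, U.card = m ∧
        ∀ A ⊆ U, ∀ B ⊆ U, A.card = a → B.card = a → χ A = χ B) (m : ℕ) :
    ∃ p : ℕ, ∀ (T : Type) [LinearOrder T] (S : Finset T), p ≤ S.card →
      ∀ χ : Finset T → κ, ∃ U ⊆ S, U.card = m ∧
        ∀ x ∈ U, ∀ A ⊆ U, ∀ B ⊆ U, (∀ y ∈ A, x < y) → (∀ y ∈ B, x < y) →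
          A.card = a → B.card = a → χ (insert x A) = χ (insert x B) := by
  induction m with
  | zero => exact ⟨0, fun T _ S _ χ => ⟨∅, by simp, by simp, by simp⟩⟩
  | succ m ihm =>
    obtain ⟨q, hq⟩ := ihm
    obtain ⟨p, hp⟩ := ih q
    refine ⟨p + 1, fun T _ S hS χ => ?_⟩
    have hne : S.Nonempty := Finset.card_pos.mp (by omega)
    set x := S.min' hne with hx
    obtain ⟨U, hUS, hUc, hU⟩ := hp T (S.erase x)
      (by rw [Finset.card_erase_of_mem (S.min'_mem hne)]; omega) (fun A => χ (insert x A))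
    obtain ⟨W, hWU, hWc, hW⟩ := hq T U hUc.ge χ
    have hlt : ∀ y ∈ W, x < y := fun y hy => S.min'_lt_of_mem_erase_min' hne (hUS (hWU hy))
    have hxW : x ∉ W := fun h => (hlt x h).false
    have hsub : ∀ z ∈ insert x W, ∀ A ⊆ insert x W, (∀ y ∈ A, z < y) → A ⊆ W := by
      intro z hz A hA hzA y hy
      rcases Finset.mem_insert.mp (hA hy) with rfl | h
      · rcases Finset.mem_insert.mp hz with rfl | h'
        · exact absurd (hzA _ hy) (lt_irrefl _)
        · exact absurd ((hzA _ hy).trans (hlt _ h')) (lt_irrefl _)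
      · exact h
    refine ⟨insert x W, ?_, by rw [Finset.card_insert_of_notMem hxW, hWc], ?_⟩
    · exact Finset.insert_subset (S.min'_mem hne)
        ((hWU.trans hUS).trans (Finset.erase_subset _ _))
    · intro z hz A hA B hB hzA hzB hAc hBc
      have hA' := hsub z hz A hA hzA
      have hB' := hsub z hz B hB hzB
      rcases Finset.mem_insert.mp hz with rfl | h
      · exact hU A (hA'.trans hWU) B (hB'.trans hWU) hAc hBc
      · exact hW z h A hA' B hB' hzA hzB hAc hBc

/-- Finite **Ramsey theorem** for `a`-subsets. -/
theorem finite_ramsey {κ : Type} [Finite κ] (a : ℕ) : ∀ m : ℕ,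
    ∃ p : ℕ, ∀ (T : Type) [LinearOrder T] (S : Finset T), p ≤ S.card →
      ∀ χ : Finset T → κ, ∃ U ⊆ S, U.card = m ∧
        ∀ A ⊆ U, ∀ B ⊆ U, A.card = a → B.card = a → χ A = χ B := by
  classical
  induction a with
  | zero =>
    intro m
    refine ⟨m, fun T _ S hS χ => ?_⟩
    obtain ⟨U, hU, hc⟩ := Finset.exists_subset_card_eq hS
    refine ⟨U, hU, hc, fun A _ B _ hA hB => ?_⟩
    rw [Finset.card_eq_zero.mp hA, Finset.card_eq_zero.mp hB]
  | succ a ih =>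
    intro m
    have := Fintype.ofFinite κ
    obtain ⟨p, hp⟩ := exists_min_determined_subset a ih (Fintype.card (Set κ) * m)
    refine ⟨p, fun T _ S hS χ => ?_⟩
    obtain ⟨U, hUS, hUc, hU⟩ := hp T S hS χ
    let col : T → Set κ := fun x =>
      {k | ∃ A ⊆ U, (∀ y ∈ A, x < y) ∧ A.card = a ∧ χ (insert x A) = k}
    obtain ⟨W, hWU, hWc, hW⟩ : ∃ W ⊆ U, W.card = m ∧ ∀ x ∈ W, ∀ y ∈ W, ∀ k ∈ col x, ∀ l ∈ col y,
        k = l := by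
      have hcol : ∀ x ∈ U, ∀ k ∈ col x, ∀ l ∈ col x, k = l := by
        rintro x hx k ⟨A, hA, hxA, hAc, rfl⟩ l ⟨B, hB, hxB, hBc, rfl⟩
        exact hU x hx A hA B hB hxA hxB hAc hBc
      obtain ⟨c, -, hc⟩ := Finset.exists_le_card_fiber_of_mul_le_card_of_maps_to (n := m)
        (fun x _ => Finset.mem_univ (col x)) Finset.univ_nonempty (by rw [Finset.card_univ, hUc])
      obtain ⟨W, hW, hWc⟩ := Finset.exists_subset_card_eq hc
      refine ⟨W, fun x hx => (Finset.mem_filter.mp (hW hx)).1, hWc,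
        fun x hx y hy k hk l hl => ?_⟩
      obtain ⟨hxU, hxc⟩ := Finset.mem_filter.mp (hW hx)
      obtain ⟨-, hyc⟩ := Finset.mem_filter.mp (hW hy)
      exact hcol x hxU k hk l (by rwa [hxc, ← hyc])
    refine ⟨W, hWU.trans hUS, hWc, fun A hA B hB hAc hBc => ?_⟩
    have key : ∀ A ⊆ W, A.card = a + 1 → ∃ x ∈ W, χ A ∈ col x := by
      intro A hA hAc
      have hne : A.Nonempty := Finset.card_pos.mp (by omega)
      refine ⟨A.min' hne, hA (A.min'_mem hne), A.erase (A.min' hne),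
        (Finset.erase_subset _ _).trans (hA.trans hWU),
        fun y hy => A.min'_lt_of_mem_erase_min' hne hy, ?_, ?_⟩
      · rw [Finset.card_erase_of_mem (A.min'_mem hne), hAc]; rfl
      · rw [Finset.insert_erase (A.min'_mem hne)]
    obtain ⟨x, hx, hxA⟩ := key A hA hAc
    obtain ⟨y, hy, hyB⟩ := key B hB hBc
    exact hW x hx y hy _ hxA _ hyB

/-- Finite Ramsey theorem for strictly increasing maps. -/
theorem finite_ramsey_strictMono (κ : Type) [Finite κ] (a b : ℕ) :
    ∃ p : ℕ, ∀ χ : (Fin a → Fin p) → κ, ∃ g : Fin b → Fin p, StrictMono g ∧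
      ∀ f f' : Fin a → Fin b, StrictMono f → StrictMono f' → χ (g ∘ f) = χ (g ∘ f') := by
  obtain ⟨p, hp⟩ := finite_ramsey (κ := Set κ) a b
  refine ⟨p, fun χ => ?_⟩
  obtain ⟨U, -, hUc, hU⟩ := hp (Fin p) Finset.univ (by simp)
    (fun A => {k | ∃ f : Fin a → Fin p, StrictMono f ∧ Finset.univ.image f = A ∧ χ f = k})
  refine ⟨U.orderEmbOfFin hUc, (U.orderEmbOfFin hUc).strictMono, fun f f' hf hf' => ?_⟩
  have hsub : ∀ f : Fin a → Fin b, Finset.univ.image (U.orderEmbOfFin hUc ∘ f) ⊆ U := by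
    intro f x hx
    obtain ⟨i, -, rfl⟩ := Finset.mem_image.mp hx
    exact U.orderEmbOfFin_mem hUc _
  have hmono : ∀ f : Fin a → Fin b, StrictMono f → StrictMono (U.orderEmbOfFin hUc ∘ f) :=
    fun f hf => (U.orderEmbOfFin hUc).strictMono.comp hf
  have hcard : ∀ f : Fin a → Fin b, StrictMono f →
      (Finset.univ.image (U.orderEmbOfFin hUc ∘ f)).card = a := by
    intro f hf
    rw [Finset.card_image_of_injective _ (hmono f hf).injective, Finset.card_fin]
  have h := hU _ (hsub f) _ (hsub f') (hcard f hf) (hcard f' hf')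
  obtain ⟨f'', h₁, h₂, h₃⟩ := h.le ⟨_, hmono f hf, rfl, rfl⟩
  rw [← h₃, (h₁.range_inj (hmono f' hf')).mp]
  simpa [Function.comp_def] using congrArg (fun s : Finset (Fin p) => (s : Set (Fin p))) h₂

/-- `f` is an induced copy of `X` in `P` lying over `s` with respect to `π`. -/
def IsTransversal {a : ℕ} {V W : Type} (X : SimpleGraph (Fin a)) (P : SimpleGraph V) (π : V → W)
    (s : Fin a → W) (f : Fin a → V) : Prop :=
  π ∘ f = s ∧ ∀ i j, P.Adj (f i) (f j) ↔ X.Adj i j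

open Classical in
/-- The embedding of the vertices of a partite system, along a combinatorial line, into the
amalgam of its copies over a Hales-Jewett cube of transversal copies. Vertices over `s` are sent to
the cube and all others to a private copy indexed by the line. -/
noncomputable def lineMap {a : ℕ} {V W ι : Type} {M : Set (Fin a → V)} (π : V → W) (s : Fin a → W)
    (L : Combinatorics.Line M ι) (v : V) : (Fin a × (ι → V)) ⊕ (Combinatorics.Line M ι × V) :=
  if h : ∃ j, s j = π v then
    Sum.inl (h.choose, fun t => (L.idxFun t).elim v fun x => x.1 h.choose)
  else Sum.inr (L, v)

theorem lineMap_of_eq {a : ℕ} {V W ι : Type} {M : Set (Fin a → V)} {π : V → W} {s : Fin a → W}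
    (hs : Function.Injective s) (L : Combinatorics.Line M ι) {v : V} {j : Fin a} (h : s j = π v) :
    lineMap π s L v = Sum.inl (j, fun t => (L.idxFun t).elim v fun x => x.1 j) := by
  have h' : ∃ j, s j = π v := ⟨j, h⟩
  have : h'.choose = j := hs (h'.choose_spec.trans h.symm)
  rw [lineMap, dif_pos h', this]

theorem lineMap_of_ne {a : ℕ} {V W ι : Type} {M : Set (Fin a → V)} {π : V → W} {s : Fin a → W}
    (L : Combinatorics.Line M ι) {v : V} (h : ¬ ∃ j, s j = π v) :
    lineMap π s L v = Sum.inr (L, v) := dif_neg h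

/-- The projection of the amalgam. -/
def amalgamProj {a : ℕ} {V W ι Λ : Type} (π : V → W) (s : Fin a → W) :
    (Fin a × (ι → V)) ⊕ (Λ × V) → W :=
  Sum.elim (fun x => s x.1) (fun x => π x.2)

theorem amalgamProj_lineMap {a : ℕ} {V W ι : Type} {M : Set (Fin a → V)} {π : V → W}
    {s : Fin a → W} (hs : Function.Injective s) (L : Combinatorics.Line M ι) (v : V) :
    amalgamProj π s (lineMap π s L v) = π v := by
  by_cases h : ∃ j, s j = π v
  · obtain ⟨j, hj⟩ := h
    rw [lineMap_of_eq hs L hj, ← hj]; rfl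
  · rw [lineMap_of_ne L h]; rfl

theorem lineMap_injective {a : ℕ} {V W ι : Type} {M : Set (Fin a → V)} {π : V → W}
    {s : Fin a → W} (hs : Function.Injective s) (L : Combinatorics.Line M ι) :
    Function.Injective (lineMap π s L) := by
  intro u v h
  have hπ : π u = π v := by
    rw [← amalgamProj_lineMap (π := π) hs L u, h, amalgamProj_lineMap hs]
  by_cases hu : ∃ j, s j = π u
  · obtain ⟨j, hj⟩ := hu
    rw [lineMap_of_eq hs L hj, lineMap_of_eq hs L (hj.trans hπ)] at h
    obtain ⟨t, ht⟩ := L.proper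
    simpa [ht] using congrFun (Prod.ext_iff.mp (Sum.inl_injective h)).2 t
  · rw [lineMap_of_ne L hu, lineMap_of_ne L (hπ ▸ hu)] at h
    exact (Prod.ext_iff.mp (Sum.inr_injective h)).2

/-- Copies along different lines meet so that adjacency is consistent. -/
theorem adj_of_lineMap_eq {a : ℕ} {V W ι : Type} {X : SimpleGraph (Fin a)} {P : SimpleGraph V}
    {π : V → W} {s : Fin a → W} (hs : Function.Injective s)
    {L L' : Combinatorics.Line {f | IsTransversal X P π s f} ι} {u v u' v' : V}
    (hu : lineMap π s L u = lineMap π s L' u') (hv : lineMap π s L v = lineMap π s L' v')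
    (h : P.Adj u' v') : P.Adj u v := by
  by_cases hL : L = L'
  · subst hL
    rwa [lineMap_injective hs L hu, lineMap_injective hs L hv]
  have hover : ∀ {x x' : V}, lineMap π s L x = lineMap π s L' x' →
      ∃ j, s j = π x ∧ s j = π x' := by
    intro x x' hx
    have hπ : π x = π x' := by
      rw [← amalgamProj_lineMap (π := π) hs L x, hx, amalgamProj_lineMap hs]
    by_cases hj : ∃ j, s j = π x
    · obtain ⟨j, hj⟩ := hj
      exact ⟨j, hj, hj.trans hπ⟩
    · rw [lineMap_of_ne L hj, lineMap_of_ne L' (hπ ▸ hj)] at hx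
      exact absurd (Prod.ext_iff.mp (Sum.inr_injective hx)).1 hL
  obtain ⟨j, hju, hju'⟩ := hover hu
  obtain ⟨l, hlv, hlv'⟩ := hover hv
  rw [lineMap_of_eq hs L hju, lineMap_of_eq hs L' hju'] at hu
  rw [lineMap_of_eq hs L hlv, lineMap_of_eq hs L' hlv'] at hv
  have hu₂ := fun t => congrFun (Prod.ext_iff.mp (Sum.inl_injective hu)).2 t
  have hv₂ := fun t => congrFun (Prod.ext_iff.mp (Sum.inl_injective hv)).2 t
  by_cases hX : X.Adj j l
  · obtain ⟨t, ht⟩ := L.proper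
    have hu₃ := hu₂ t
    have hv₃ := hv₂ t
    cases ht' : L'.idxFun t with
    | none => simp only [ht, ht', Option.elim] at hu₃ hv₃; rwa [hu₃, hv₃]
    | some x =>
      simp only [ht, ht', Option.elim] at hu₃ hv₃
      rw [hu₃, hv₃]
      exact (x.2.2 j l).mpr hX
  · obtain ⟨t, ht⟩ := L'.proper
    have hu₃ := hu₂ t
    have hv₃ := hv₂ t
    cases ht' : L.idxFun t with
    | none => simp only [ht, ht', Option.elim] at hu₃ hv₃; rwa [hu₃, hv₃]
    | some x =>
      simp only [ht, ht', Option.elim] at hu₃ hv₃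
      rw [← hu₃, ← hv₃] at h
      exact absurd ((x.2.2 j l).mp h) hX

/-- The amalgam of the copies of `P` along all combinatorial lines. -/
def amalgam {a : ℕ} {V W ι : Type} {M : Set (Fin a → V)} (P : SimpleGraph V)
    (π : V → W) (s : Fin a → W) :
    SimpleGraph ((Fin a × (ι → V)) ⊕ (Combinatorics.Line M ι × V)) where
  Adj x y := x ≠ y ∧ ∃ L u v, lineMap π s L u = x ∧ lineMap π s L v = y ∧ P.Adj u v
  symm := ⟨fun _ _ ⟨hne, L, u, v, hu, hv, h⟩ => ⟨hne.symm, L, v, u, hv, hu, h.symm⟩⟩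
  loopless := ⟨fun _ h => h.1 rfl⟩

theorem amalgam_adj_lineMap {a : ℕ} {V W ι : Type} {X : SimpleGraph (Fin a)} {P : SimpleGraph V}
    {π : V → W} {s : Fin a → W} (hs : Function.Injective s)
    (L : Combinatorics.Line {f | IsTransversal X P π s f} ι) (u v : V) :
    (amalgam P π s).Adj (lineMap π s L u) (lineMap π s L v) ↔ P.Adj u v := by
  constructor
  · rintro ⟨-, L', u', v', hu, hv, h⟩
    exact adj_of_lineMap_eq hs hu.symm hv.symm h
  · exact fun h => ⟨(lineMap_injective hs L).ne h.ne, L, u, v, rfl, rfl, h⟩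

theorem lineMap_comp_transversal {a : ℕ} {V W ι : Type} {X : SimpleGraph (Fin a)}
    {P : SimpleGraph V} {π : V → W} {s : Fin a → W} (hs : Function.Injective s)
    (L : Combinatorics.Line {f | IsTransversal X P π s f} ι)
    (f : {f | IsTransversal X P π s f}) :
    lineMap π s L ∘ f.1 = fun j => Sum.inl (j, fun t => (L f t).1 j) := by
  funext j
  rw [Function.comp_apply, lineMap_of_eq hs L (congrFun f.2.1 j).symm]
  congr 2
  funext t
  cases ht : L.idxFun t <;> simp [ht]

theorem amalgam_proj_adj {a : ℕ} {V W ι : Type} {M : Set (Fin a → V)} {P : SimpleGraph V}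
    {G : SimpleGraph W} {π : V → W} (hπ : ∀ u v, P.Adj u v → G.Adj (π u) (π v)) {s : Fin a → W}
    (hs : Function.Injective s) (x y : (Fin a × (ι → V)) ⊕ (Combinatorics.Line M ι × V))
    (h : (amalgam P π s).Adj x y) : G.Adj (amalgamProj π s x) (amalgamProj π s y) := by
  obtain ⟨-, L, u, v, rfl, rfl, huv⟩ := h
  rw [amalgamProj_lineMap hs, amalgamProj_lineMap hs]
  exact hπ u v huv

theorem cliqueFree_iff_forall_exists_not_adj {V : Type} {G : SimpleGraph V} {n : ℕ} :
    G.CliqueFree n ↔ ∀ c : Fin n → V, ∃ i j, i ≠ j ∧ ¬ G.Adj (c i) (c j) := by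
  rw [SimpleGraph.cliqueFree_iff]
  constructor
  · intro h c
    by_contra! hc
    let φ : SimpleGraph.completeGraph (Fin n) →g G := ⟨c, fun {i j} hij => hc i j hij⟩
    exact h.false ⟨φ, SimpleGraph.Hom.injective_of_top_hom φ⟩
  · refine fun h => ⟨fun c => ?_⟩
    obtain ⟨i, j, hij, hc⟩ := h c
    exact hc (c.toHom.map_adj hij)

/-- The amalgam is `K_n`-free when `X` and `P` are and `s` reflects adjacency. -/
theorem amalgam_cliqueFree {a n : ℕ} (hn : 2 ≤ n) {V W ι : Type} {X : SimpleGraph (Fin a)}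
    {P : SimpleGraph V} {G : SimpleGraph W} {π : V → W}
    (hπ : ∀ u v, P.Adj u v → G.Adj (π u) (π v)) {s : Fin a → W}
    (hs : Function.Injective s) (hsG : ∀ i j, G.Adj (s i) (s j) → X.Adj i j)
    (hX : X.CliqueFree n) (hP : P.CliqueFree n) :
    (amalgam P π s :
      SimpleGraph ((Fin a × (ι → V)) ⊕
        (Combinatorics.Line {f | IsTransversal X P π s f} ι × V))).CliqueFree n := by
  rw [cliqueFree_iff_forall_exists_not_adj] at hX hP ⊢
  intro c
  by_contra! hc
  by_cases hin : ∀ i, ∃ x, c i = Sum.inl x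
  · choose x hx using hin
    obtain ⟨i, j, hij, hX⟩ := hX fun i => (x i).1
    have := amalgam_proj_adj hπ hs _ _ (hc i j hij)
    rw [hx, hx] at this
    exact hX (hsG _ _ this)
  · push Not at hin
    obtain ⟨i₀, hi₀⟩ := hin
    obtain ⟨⟨L, v⟩, hLv⟩ : ∃ x, c i₀ = Sum.inr x := by
      cases h : c i₀ with
      | inl x => exact absurd h (hi₀ x)
      | inr x => exact ⟨x, rfl⟩
    have hnb : ∀ i, i ≠ i₀ → ∃ u w, lineMap π s L u = c i₀ ∧ lineMap π s L w = c i := by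
      intro i hi
      obtain ⟨-, L', u, w, hu, hw, -⟩ := hc i₀ i hi.symm
      have : L' = L := by
        by_cases h : ∃ j, s j = π u
        · obtain ⟨j, hj⟩ := h
          rw [lineMap_of_eq hs L' hj, hLv] at hu
          exact absurd hu (by simp)
        · rw [lineMap_of_ne L' h, hLv] at hu
          exact (Prod.ext_iff.mp (Sum.inr_injective hu)).1
      subst this
      exact ⟨u, w, hu, hw⟩
    have hall : ∀ i, ∃ w, lineMap π s L w = c i := by
      intro i
      by_cases hi : i = i₀
      · have : Nontrivial (Fin n) := Fin.nontrivial_iff_two_le.mpr hn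
        obtain ⟨i₁, hi₁⟩ := exists_ne i₀
        obtain ⟨u, w, hu, -⟩ := hnb i₁ hi₁
        exact ⟨u, hi ▸ hu⟩
      · obtain ⟨u, w, -, hw⟩ := hnb i hi
        exact ⟨w, hw⟩
    choose w hw using hall
    obtain ⟨i, j, hij, hP⟩ := hP w
    have := hc i j hij
    rw [← hw, ← hw, amalgam_adj_lineMap hs] at this
    exact hP this

/-- One step of the partite construction: copies of `X` over a fixed `s` become monochromatic. -/
theorem partite_step {a : ℕ} {V W : Type} [Finite V] (κ : Type) [Finite κ]
    (X : SimpleGraph (Fin a)) (P : SimpleGraph V) (G : SimpleGraph W) (π : V → W)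
    (hπ : ∀ u v, P.Adj u v → G.Adj (π u) (π v)) (s : Fin a → W) (hs : Function.Injective s) :
    ∃ (Q : Type) (_ : Finite Q) (R : SimpleGraph Q) (ρ : Q → W),
      (∀ u v, R.Adj u v → G.Adj (ρ u) (ρ v)) ∧
      (∀ n, 2 ≤ n → X.CliqueFree n → P.CliqueFree n →
        (∀ i j, G.Adj (s i) (s j) → X.Adj i j) → R.CliqueFree n) ∧
      ∀ α : (Fin a → Q) → κ, ∃ e : V → Q, (∀ u v, R.Adj (e u) (e v) ↔ P.Adj u v) ∧
        (∀ v, ρ (e v) = π v) ∧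
        ∀ f g, IsTransversal X P π s f → IsTransversal X P π s g → α (e ∘ f) = α (e ∘ g) := by
  obtain ⟨ι, _, hι⟩ :=
    Combinatorics.Line.exists_mono_in_high_dimension {f | IsTransversal X P π s f} κ
  have : Finite (Combinatorics.Line {f | IsTransversal X P π s f} ι) :=
    Finite.of_injective (fun L => L.idxFun) fun _ _ => Combinatorics.Line.ext
  refine ⟨_, inferInstance,
    (amalgam P π s : SimpleGraph ((Fin a × (ι → V)) ⊕
        (Combinatorics.Line {f | IsTransversal X P π s f} ι × V))), amalgamProj π s,
    amalgam_proj_adj hπ hs, fun n hn hX hP hsG => amalgam_cliqueFree hn hπ hs hsG hX hP,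
    fun α => ?_⟩
  obtain ⟨L, k, hL⟩ := hι fun x => α fun j => Sum.inl (j, fun t => (x t).1 j)
  refine ⟨lineMap π s L, amalgam_adj_lineMap hs L, amalgamProj_lineMap hs L, fun f g hf hg => ?_⟩
  rw [lineMap_comp_transversal hs L ⟨f, hf⟩, lineMap_comp_transversal hs L ⟨g, hg⟩]
  exact (hL ⟨f, hf⟩).trans (hL ⟨g, hg⟩).symm

/-- The **partite construction** for a finite list of positions of `X`. -/
theorem partite_construction {a : ℕ} {W : Type} (κ : Type) [Finite κ]
    (X : SimpleGraph (Fin a)) (G : SimpleGraph W) (S : List (Fin a → W))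
    (hS : ∀ s ∈ S, Function.Injective s) :
    ∀ (V : Type) [Finite V] (P : SimpleGraph V) (π : V → W),
    (∀ u v, P.Adj u v → G.Adj (π u) (π v)) →
    ∃ (Q : Type) (_ : Finite Q) (R : SimpleGraph Q) (ρ : Q → W),
      (∀ u v, R.Adj u v → G.Adj (ρ u) (ρ v)) ∧
      (∀ n, 2 ≤ n → X.CliqueFree n → P.CliqueFree n →
        (∀ s ∈ S, ∀ i j, G.Adj (s i) (s j) → X.Adj i j) → R.CliqueFree n) ∧
      ∀ α : (Fin a → Q) → κ, ∃ e : V → Q, (∀ u v, R.Adj (e u) (e v) ↔ P.Adj u v) ∧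
        (∀ v, ρ (e v) = π v) ∧
        ∀ s ∈ S, ∀ f g, IsTransversal X P π s f → IsTransversal X P π s g →
          α (e ∘ f) = α (e ∘ g) := by
  induction S with
  | nil =>
    intro V _ P π hπ
    exact ⟨V, inferInstance, P, π, hπ, fun n _ _ hP _ => hP, fun α =>
      ⟨id, fun u v => Iff.rfl, fun v => rfl, by simp⟩⟩
  | cons s S ih =>
    intro V _ P π hπ
    obtain ⟨V₁, _, P₁, π₁, hπ₁, hfree₁, hR₁⟩ :=
      partite_step κ X P G π hπ s (hS s List.mem_cons_self)
    obtain ⟨Q, hQ, R, ρ, hρ, hfree, hR⟩ :=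
      ih (fun t ht => hS t (List.mem_cons_of_mem _ ht)) V₁ P₁ π₁ hπ₁
    refine ⟨Q, hQ, R, ρ, hρ, fun n hn hX hP hG => ?_, fun α => ?_⟩
    · exact hfree n hn hX (hfree₁ n hn hX hP (hG s List.mem_cons_self))
        fun t ht => hG t (List.mem_cons_of_mem _ ht)
    · obtain ⟨e₂, hadj₂, hover₂, hmono₂⟩ := hR α
      obtain ⟨e₁, hadj₁, hover₁, hmono₁⟩ := hR₁ fun f => α (e₂ ∘ f)
      refine ⟨e₂ ∘ e₁, fun u v => (hadj₂ _ _).trans (hadj₁ u v),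
        fun v => (hover₂ _).trans (hover₁ v), fun t ht f g hf hg => ?_⟩
      have lift : ∀ f, IsTransversal X P π t f → IsTransversal X P₁ π₁ t (e₁ ∘ f) :=
        fun f hf => ⟨by rw [← hf.1]; exact funext fun i => hover₁ (f i),
          fun i j => (hadj₁ _ _).trans (hf.2 i j)⟩
      rcases List.mem_cons.mp ht with rfl | ht
      · exact hmono₁ f g hf hg
      · exact hmono₂ t ht _ _ (lift f hf) (lift g hg)

/-- A finite set with a map to a linear order can be enumerated monotonically along that map. -/
theorem exists_equiv_fin_lt_of_lt {Q W : Type} [Finite Q] [LinearOrder W] (ρ : Q → W) :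
    ∃ (c : ℕ) (o : Q ≃ Fin c), ∀ u v, ρ u < ρ v → o u < o v := by
  have := Fintype.ofFinite Q
  let q := Fintype.equivFin Q
  let _ : LinearOrder Q := LinearOrder.lift' (fun v => toLex (ρ v, q v)) fun u v h =>
    q.injective (Prod.ext_iff.mp (toLex.injective h)).2
  refine ⟨Fintype.card Q, (Fintype.orderIsoFinOfCardEq Q rfl).symm.toEquiv, fun u v h => ?_⟩
  exact (Fintype.orderIsoFinOfCardEq Q rfl).symm.strictMono
    (show toLex (ρ u, q u) < toLex (ρ v, q v) from Prod.Lex.toLex_lt_toLex.mpr (Or.inl h))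

/-- If every colouring of the positions of `X` in `G` is constant on some position of `Y`, then
there is a Ramsey graph for `X` and `Y`, which is `K_n`-free under suitable conditions. -/
theorem exists_ramsey_of_positions {a b p : ℕ} (κ : Type) [Finite κ]
    (X : SimpleGraph (Fin a)) (Y : SimpleGraph (Fin b)) (G : SimpleGraph (Fin p))
    (S : Set (Fin a → Fin p)) (T : Set (Fin b → Fin p))
    (hS : ∀ s ∈ S, Function.Injective s) (hT : ∀ g ∈ T, StrictMono g)
    (hTG : ∀ g ∈ T, ∀ i j, Y.Adj i j → G.Adj (g i) (g j))
    (hST : ∀ g ∈ T, ∀ f, OrdEmb X Y f → g ∘ f ∈ S)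
    (hram : ∀ χ : (Fin a → Fin p) → Set κ, ∃ g ∈ T,
      ∀ f f' : Fin a → Fin b, OrdEmb X Y f → OrdEmb X Y f' → χ (g ∘ f) = χ (g ∘ f')) :
    ∃ (c : ℕ) (Z : SimpleGraph (Fin c)),
      (∀ n, 2 ≤ n → X.CliqueFree n → Y.CliqueFree n →
        (∀ s ∈ S, ∀ i j, G.Adj (s i) (s j) → X.Adj i j) → Z.CliqueFree n) ∧
      ∀ α : (Fin a → Fin c) → κ,
        ∃ e : Fin b → Fin c, OrdEmb Y Z e ∧
          ∀ f g : Fin a → Fin b, OrdEmb X Y f → OrdEmb X Y g →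
            α (e ∘ f) = α (e ∘ g) := by
  have hfin := S.toFinite
  let P : SimpleGraph (T × Fin b) :=
    { Adj := fun x y => x.1 = y.1 ∧ Y.Adj x.2 y.2
      symm := ⟨fun _ _ h => ⟨h.1.symm, h.2.symm⟩⟩
      loopless := ⟨fun _ h => h.2.ne rfl⟩ }
  let π : T × Fin b → Fin p := fun x => x.1.1 x.2
  have hπ : ∀ u v, P.Adj u v → G.Adj (π u) (π v) := by
    rintro ⟨g, i⟩ ⟨g', j⟩ ⟨h, hij⟩
    obtain rfl : g = g' := h
    exact hTG g.1 g.2 i j hij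
  obtain ⟨Q, _, R, ρ, hρ, hfree, hR⟩ := partite_construction κ X G hfin.toFinset.toList
    (fun s hs => hS s (by simpa using hs)) (T × Fin b) P π hπ
  obtain ⟨c, o, ho⟩ := exists_equiv_fin_lt_of_lt ρ
  refine ⟨c, R.comap o.symm, fun n hn hX hY hG => ?_, fun α => ?_⟩
  · have hP : P.CliqueFree n := by
      rw [cliqueFree_iff_forall_exists_not_adj] at hY ⊢
      intro x
      obtain ⟨i, j, hij, hx⟩ := hY fun i => (x i).2
      exact ⟨i, j, hij, fun h => hx h.2⟩
    have := hfree n hn hX hP fun s hs => hG s (by simpa using hs)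
    rw [cliqueFree_iff_forall_exists_not_adj] at this ⊢
    exact fun x => this (o.symm ∘ x)
  · obtain ⟨e, hadj, hover, hmono⟩ := hR fun f => α (o ∘ f)
    obtain ⟨g, hg, hχ⟩ := hram fun s => {k | ∃ f, IsTransversal X P π s f ∧ α (o ∘ e ∘ f) = k}
    let y : Fin b → T × Fin b := fun i => (⟨g, hg⟩, i)
    have hy : ∀ f, OrdEmb X Y f → IsTransversal X P π (g ∘ f) (y ∘ f) := fun f hf =>
      ⟨rfl, fun i j => ⟨fun h => (hf.2 i j).mp h.2, fun h => ⟨rfl, (hf.2 i j).mpr h⟩⟩⟩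
    refine ⟨o ∘ e ∘ y, ⟨fun i j hij => ho _ _ ?_, fun i j => ?_⟩, fun f f' hf hf' => ?_⟩
    · rw [Function.comp_apply, Function.comp_apply, hover, hover]
      exact hT g hg hij
    · simp [hadj, P, y]
    · obtain ⟨f'', h₁, h₂⟩ := (hχ f f' hf hf').le ⟨y ∘ f, hy f hf, rfl⟩
      exact h₂.symm.trans
        (hmono (g ∘ f') (by simpa using hST g hg f' hf') _ _ h₁ (hy f' hf'))

/-- The class of all finite ordered graphs has the Ramsey property. -/
theorem ordered_graph_ramsey {a b : ℕ} (κ : Type) [Finite κ]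
    (X : SimpleGraph (Fin a)) (Y : SimpleGraph (Fin b)) :
    ∃ (c : ℕ) (Z : SimpleGraph (Fin c)), ∀ α : (Fin a → Fin c) → κ,
      ∃ e : Fin b → Fin c, OrdEmb Y Z e ∧
        ∀ f g : Fin a → Fin b, OrdEmb X Y f → OrdEmb X Y g → α (e ∘ f) = α (e ∘ g) := by
  obtain ⟨p, hp⟩ := finite_ramsey_strictMono (Set κ) a b
  obtain ⟨c, Z, -, hZ⟩ := exists_ramsey_of_positions κ X Y (⊤ : SimpleGraph (Fin p))
    {s | StrictMono s} {g | StrictMono g} (fun s hs => StrictMono.injective hs) (fun g hg => hg)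
    (fun g hg i j hij => (StrictMono.injective hg).ne hij.ne)
    (fun g hg f hf => StrictMono.comp hg hf.1)
    (fun χ => by
      obtain ⟨g, hg, h⟩ := hp χ
      exact ⟨g, hg, fun f f' hf hf' => h f f' hf.1 hf'.1⟩)
  exact ⟨c, Z, hZ⟩

/-- the class of finite ordered `K_n`-free graphs has the Ramsey property. -/
theorem stmt_0 (n : ℕ) (hn : 3 ≤ n) (a b : ℕ)
    (X : SimpleGraph (Fin a)) (Y : SimpleGraph (Fin b))
    (hX : X.CliqueFree n) (hY : Y.CliqueFree n) (k : ℕ) :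
    ∃ (c : ℕ) (Z : SimpleGraph (Fin c)), Z.CliqueFree n ∧
      ∀ α : (Fin a → Fin c) → Fin k,
        ∃ e : Fin b → Fin c, OrdEmb Y Z e ∧
          ∀ f g : Fin a → Fin b, OrdEmb X Y f → OrdEmb X Y g →
            α (e ∘ f) = α (e ∘ g) := by
  obtain ⟨p, G, hG⟩ := ordered_graph_ramsey (Set (Fin k)) X Y
  obtain ⟨c, Z, hfree, hZ⟩ := exists_ramsey_of_positions (Fin k) X Y G {s | OrdEmb X G s}
    {g | OrdEmb Y G g} (fun s hs => hs.1.injective) (fun g hg => hg.1)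
    (fun g hg i j hij => (hg.2 i j).mpr hij)
    (fun g hg f hf => ⟨hg.1.comp hf.1, fun i j => (hg.2 _ _).trans (hf.2 i j)⟩) hG
  exact ⟨c, Z, hfree n (by omega) hX hY fun s hs i j => (hs.2 i j).mp, hZ⟩
end

section
/- Fix an integer n ≥ 1. The class K^<_n of all finite ordered [n]-colored graphs has the Ramsey property: for all X̂, Ŷ ∈ K^<_n and every k ∈ ℕ there exists Ẑ ∈ K^<_n such that for every map α from the copies of X̂ in Ẑ to {1,…,k} there is a copy Ỹ of Ŷ in Ẑ on whose copies of X̂ the map α is constant. -/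
open Filter in
/-- The limit of a function into a finite type along an ultrafilter. -/
theorem Ultrafilter.exists_eventually_eq {β κ : Type*} [Finite κ] (U : Ultrafilter β)
    (f : β → κ) : ∃ d, ∀ᶠ x in (U : Filter β), f x = d := by
  exact U.eventually_exists_iff.1 (Eventually.of_forall fun x => ⟨f x, rfl⟩)

open Filter in
/-- The infinite Ramsey theorem for colorings of finite sets, in the form asserting arbitrarily
large finite homogeneous sets. -/
theorem exists_homogeneous_finset {κ : Type*} [Finite κ] (c : Finset ℕ → κ) (a b : ℕ) :
    ∃ T : Finset ℕ, T.card = b ∧ ∃ d, ∀ S ⊆ T, S.card = a → c S = d := by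
  let U : Ultrafilter ℕ := hyperfilter ℕ
  choose lim hlim using fun f : ℕ → κ => U.exists_eventually_eq f
  let L : ℕ → Finset ℕ → κ := fun j =>
    Nat.rec c (fun _ F S => lim fun x => F (insert x S)) j
  have hL : ∀ j S, ∀ᶠ x in (U : Filter ℕ), L j (insert x S) = L (j + 1) S :=
    fun j S => hlim _
  suffices h : ∃ T : Finset ℕ, T.card = b ∧ ∀ S ⊆ T, ∀ j, j + S.card = a → L j S = L a ∅ by
    obtain ⟨T, hT, h⟩ := h
    exact ⟨T, hT, L a ∅, fun S hS hc => h S hS 0 (by omega)⟩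
  induction b with
  | zero =>
    refine ⟨∅, rfl, fun S hS j hj => ?_⟩
    obtain rfl := Finset.subset_empty.1 hS
    simp at hj
    rw [hj]
  | succ b ih =>
    obtain ⟨T, hT, h⟩ := ih
    have h1 : ∀ᶠ x in (U : Filter ℕ), x ∉ T :=
      (hyperfilter_le_cofinite (α := ℕ)) T.finite_toSet.compl_mem_cofinite
    have h2 : ∀ᶠ x in (U : Filter ℕ), ∀ S ∈ T.powerset, ∀ j ∈ Finset.range a,
        L j (insert x S) = L (j + 1) S := by
      simp only [Finset.eventually_all]
      exact fun S _ j _ => hL j S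
    obtain ⟨x, hxT, hx⟩ := (h1.and h2).exists
    refine ⟨insert x T, by rw [Finset.card_insert_of_notMem hxT, hT], fun S hS j hj => ?_⟩
    by_cases hxS : x ∈ S
    · have hsub : S.erase x ⊆ T := by
        rw [← Finset.subset_insert_iff]; exact hS
      have hcard := Finset.card_erase_add_one hxS
      have := hx (S.erase x) (Finset.mem_powerset.2 hsub) j (Finset.mem_range.2 (by omega))
      rw [Finset.insert_erase hxS] at this
      rw [this]
      exact h _ hsub (j + 1) (by omega)
    · exact h S ((Finset.subset_insert_iff_of_notMem hxS).1 hS) j hj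

open Filter in
/-- The finite Ramsey theorem for hypergraphs. -/
theorem exists_ramsey_number (κ : Type*) [Finite κ] (a b : ℕ) :
    ∃ p : ℕ, ∀ c : Finset (Fin p) → κ,
      ∃ T : Finset (Fin p), T.card = b ∧ ∃ d, ∀ S ⊆ T, S.card = a → c S = d := by
  by_contra! hbad
  choose c hc using hbad
  let c' : ℕ → Finset ℕ → κ := fun p S => c p (S.preimage Fin.val Fin.val_injective.injOn)
  choose c₀ hc₀ using fun S => (hyperfilter ℕ).exists_eventually_eq fun p => c' p S
  obtain ⟨T, hT, d, hd⟩ := exists_homogeneous_finset c₀ a b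
  have h1 : ∀ᶠ p in (hyperfilter ℕ : Filter ℕ), ∀ S ∈ T.powerset, c' p S = c₀ S := by
    simp only [Finset.eventually_all]
    exact fun S _ => hc₀ S
  have h2 : ∀ᶠ p in (hyperfilter ℕ : Filter ℕ), ∀ x ∈ T, x < p := by
    simp only [Finset.eventually_all]
    exact fun x _ => Nat.hyperfilter_le_atTop (eventually_gt_atTop x)
  obtain ⟨p, hp, hlt⟩ := (h1.and h2).exists
  obtain ⟨S, hST, hSa, hne⟩ := hc p (T.attachFin hlt) (by rw [Finset.card_attachFin, hT]) d
  have hsub : S.map Fin.valEmbedding ⊆ T := by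
    intro x hx
    obtain ⟨y, hy, rfl⟩ := Finset.mem_map.1 hx
    exact (Finset.mem_attachFin hlt).1 (hST hy)
  apply hne
  have h := hp _ (Finset.mem_powerset.2 hsub)
  rw [hd _ hsub (by rw [Finset.card_map, hSa])] at h
  rw [← h]
  change c p S = c p _
  congr 1
  ext y
  simp [Fin.val_inj]

/-- A finite graph whose vertices carry labels in `Q`, such that adjacent vertices have labels of
different colors under `col`. -/
structure LabelledGraph {Q C : Type} (col : Q → C) where
  /-- The vertex type. -/
  V : Type
  finite : Finite V
  /-- The underlying graph. -/
  graph : SimpleGraph V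
  /-- The label of a vertex. -/
  label : V → Q
  proper : ∀ u v, graph.Adj u v → col (label u) ≠ col (label v)

namespace LabelledGraph

variable {Q C : Type} {col : Q → C}

/-- `e` preserves labels, and preserves and reflects adjacency. -/
def IsEmb (P P' : LabelledGraph col) (e : P.V → P'.V) : Prop :=
  (∀ v, P'.label (e v) = P.label v) ∧ ∀ u v, P'.graph.Adj (e u) (e v) ↔ P.graph.Adj u v

/-- `f` embeds `X` into `P` as an induced subgraph whose vertices have the labels `s`. -/
def IsCopyAt (P : LabelledGraph col) {A : Type} (X : SimpleGraph A) (s : A → Q)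
    (f : A → P.V) : Prop :=
  (∀ i, P.label (f i) = s i) ∧ ∀ i j, P.graph.Adj (f i) (f j) ↔ X.Adj i j

theorem IsCopyAt.comp {P P' : LabelledGraph col} {A : Type} {X : SimpleGraph A} {s : A → Q}
    {f : A → P.V} (hf : P.IsCopyAt X s f) {e : P.V → P'.V} (he : P.IsEmb P' e) :
    P'.IsCopyAt X s (e ∘ f) :=
  ⟨fun i => (he.1 _).trans (hf.1 i), fun i j => (he.2 _ _).trans (hf.2 i j)⟩

theorem IsEmb.comp {P P' P'' : LabelledGraph col} {e : P.V → P'.V} {e' : P'.V → P''.V}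
    (he' : P'.IsEmb P'' e') (he : P.IsEmb P' e) : P.IsEmb P'' (e' ∘ e) :=
  ⟨fun v => (he'.1 _).trans (he.1 v), fun u v => (he'.2 _ _).trans (he.2 u v)⟩

open Combinatorics

/-- The coordinates of the image of `v` under the embedding given by a combinatorial line `l` of
copies of `X`: `v` itself at active coordinates, and the vertex with the label of `v`
in the given copy at the others. -/
noncomputable def lineWord (P : LabelledGraph col) {A ι : Type} {X : SimpleGraph A} {s : A → Q}
    (l : ι → Option {f // P.IsCopyAt X s f}) (v : P.V) (t : ι) : P.V :=
  (l t).elim v fun f => Function.extend s f.1 (fun _ => v) (P.label v)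

open Classical in
/-- The embedding given by a combinatorial line `l` of copies of `X`. Vertices whose label is not
in the range of `s` remember the line. -/
noncomputable def lineEmb (P : LabelledGraph col) {A ι : Type} {X : SimpleGraph A} {s : A → Q}
    (l : ι → Option {f // P.IsCopyAt X s f}) (v : P.V) :
    Q × Option (ι → Option {f // P.IsCopyAt X s f}) × (ι → P.V) :=
  (P.label v, if P.label v ∈ Set.range s then none else some l, P.lineWord l v)

section Line

variable {P : LabelledGraph col} {A ι : Type} {X : SimpleGraph A} {s : A → Q}
  {l l' : ι → Option {f // P.IsCopyAt X s f}} {u u' v v' : P.V}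

theorem lineWord_of_none {t : ι} (h : l t = none) : P.lineWord l v t = v := by
  simp [lineWord, h]

theorem lineWord_of_some (hs : Function.Injective s) {t : ι} {f : {f // P.IsCopyAt X s f}}
    (h : l t = some f) {i : A} (hv : P.label v = s i) : P.lineWord l v t = f.1 i := by
  simp [lineWord, h, hv, hs.extend_apply]

theorem lineEmb_injective (hl : ∃ t, l t = none) : Function.Injective (P.lineEmb l) := by
  obtain ⟨t, ht⟩ := hl
  intro u v h
  have := congrFun (congrArg (fun x => x.2.2) h) t
  simpa [lineEmb, lineWord_of_none ht] using this

theorem eq_of_lineEmb_eq (h : P.lineEmb l u = P.lineEmb l' u')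
    (hu : P.label u' ∉ Set.range s) : l = l' := by
  have h1 : P.label u = P.label u' := congrArg (fun x => x.1) h
  have h2 := congrArg (fun x => x.2.1) h
  simp only [lineEmb, if_neg hu, if_neg (h1 ▸ hu : P.label u ∉ Set.range s)] at h2
  exact Option.some_injective _ h2

/-- Images of line embeddings meet in a way compatible with adjacency. -/
theorem adj_of_lineEmb_eq (hs : Function.Injective s) (hl : ∃ t, l t = none)
    (hl' : ∃ t, l' t = none) (hu : P.lineEmb l u = P.lineEmb l' u')
    (hv : P.lineEmb l v = P.lineEmb l' v') (h : P.graph.Adj u' v') : P.graph.Adj u v := by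
  have same : l = l' → P.graph.Adj u v := by
    rintro rfl
    rwa [lineEmb_injective hl hu, lineEmb_injective hl hv]
  by_cases hu' : P.label u' ∈ Set.range s
  swap
  · exact same (eq_of_lineEmb_eq hu hu')
  by_cases hv' : P.label v' ∈ Set.range s
  swap
  · exact same (eq_of_lineEmb_eq hv hv')
  obtain ⟨i, hi'⟩ := hu'
  obtain ⟨j, hj'⟩ := hv'
  have hi : P.label u = s i := (congrArg (fun x => x.1) hu).trans hi'.symm
  have hj : P.label v = s j := (congrArg (fun x => x.1) hv).trans hj'.symm
  have hwu : ∀ t, P.lineWord l u t = P.lineWord l' u' t := congrFun (congrArg (fun x => x.2.2) hu)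
  have hwv : ∀ t, P.lineWord l v t = P.lineWord l' v' t := congrFun (congrArg (fun x => x.2.2) hv)
  by_cases hX : X.Adj i j
  · obtain ⟨t, ht⟩ := hl
    have h1 := hwu t
    have h2 := hwv t
    rw [lineWord_of_none ht] at h1 h2
    rw [h1, h2]
    cases hf : l' t with
    | none => rwa [lineWord_of_none hf, lineWord_of_none hf]
    | some f =>
      rw [lineWord_of_some hs hf hi'.symm, lineWord_of_some hs hf hj'.symm]
      exact (f.2.2 i j).2 hX
  · obtain ⟨t, ht⟩ := hl'
    have h1 := hwu t
    have h2 := hwv t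
    rw [lineWord_of_none ht] at h1 h2
    rw [← h1, ← h2] at h
    cases hf : l t with
    | none => rwa [lineWord_of_none hf, lineWord_of_none hf] at h
    | some f =>
      rw [lineWord_of_some hs hf hi, lineWord_of_some hs hf hj] at h
      exact absurd ((f.2.2 i j).1 h) hX

end Line

/-- The amalgam of the copies of `P` given by all combinatorial lines of copies of `X` at `s`. -/
noncomputable def lineAmalgam (P : LabelledGraph col) [Finite Q] {A : Type} [Finite A]
    (X : SimpleGraph A) (s : A → Q) (ι : Type) [Finite ι] : LabelledGraph col where
  V := Q × Option (ι → Option {f // P.IsCopyAt X s f}) × (ι → P.V)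
  finite := by
    have := P.finite
    infer_instance
  graph :=
    { Adj := fun x y => ∃ (l : ι → Option {f // P.IsCopyAt X s f}) (u v : P.V),
        (∃ t, l t = none) ∧ P.lineEmb l u = x ∧ P.lineEmb l v = y ∧ P.graph.Adj u v
      symm := ⟨fun _ _ ⟨l, u, v, hl, hu, hv, h⟩ => ⟨l, v, u, hl, hv, hu, h.symm⟩⟩
      loopless := ⟨fun _ ⟨_, _, _, hl, hu, hv, h⟩ =>
        h.ne (lineEmb_injective hl (hu.trans hv.symm))⟩ }
  label := fun x => x.1
  proper := by
    rintro _ _ ⟨l, u, v, -, rfl, rfl, h⟩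
    exact P.proper u v h

theorem isEmb_lineEmb (P : LabelledGraph col) [Finite Q] {A : Type} [Finite A]
    (X : SimpleGraph A) {s : A → Q} (hs : Function.Injective s) (ι : Type) [Finite ι]
    {l : ι → Option {f // P.IsCopyAt X s f}} (hl : ∃ t, l t = none) :
    P.IsEmb (P.lineAmalgam X s ι) (P.lineEmb l) :=
  ⟨fun _ => rfl, fun u v => ⟨fun ⟨_, _, _, hl', hu, hv, h⟩ =>
    adj_of_lineEmb_eq hs hl hl' hu.symm hv.symm h, fun h => ⟨l, u, v, hl, rfl, rfl, h⟩⟩⟩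

/-- The partite lemma, together with amalgamation: copies of `X` at a fixed position `s` can be
made monochromatic. -/
theorem exists_ramsey_at (P : LabelledGraph col) [Finite Q] {A κ : Type} [Finite A] [Finite κ]
    (X : SimpleGraph A) {s : A → Q} (hs : Function.Injective s) :
    ∃ P' : LabelledGraph col, ∀ α : (A → P'.V) → κ, ∃ e : P.V → P'.V, P.IsEmb P' e ∧
      ∃ d, ∀ f, P.IsCopyAt X s f → α (e ∘ f) = d := by
  have := P.finite
  obtain ⟨ι, _, hι⟩ := Line.exists_mono_in_high_dimension {f // P.IsCopyAt X s f} κ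
  refine ⟨P.lineAmalgam X s ι, fun α => ?_⟩
  obtain ⟨l, d, hd⟩ := hι fun w => α fun i => (s i, none, fun t => (w t).1 i)
  refine ⟨P.lineEmb l.idxFun, P.isEmb_lineEmb X hs ι l.proper, d, fun f hf => ?_⟩
  rw [← hd ⟨f, hf⟩]
  congr 1
  funext i
  refine Prod.ext (hf.1 i) (Prod.ext (if_pos ⟨i, (hf.1 i).symm⟩) (funext fun t => ?_))
  change P.lineWord l.idxFun (f i) t = (l ⟨f, hf⟩ t).1 i
  cases h : l.idxFun t with
  | none => rw [lineWord_of_none h, Line.apply_none _ _ _ h]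
  | some g => rw [lineWord_of_some hs h (hf.1 i), Line.apply_some h]

/-- The partite construction: the color of a copy of `X` can be made to depend only on its
position. -/
theorem exists_ramsey_of_finset (P : LabelledGraph col) [Finite Q] {A κ : Type} [Finite A]
    [Finite κ] (X : SimpleGraph A) (F : Finset (A → Q)) :
    ∃ P' : LabelledGraph col, ∀ α : (A → P'.V) → κ, ∃ e : P.V → P'.V, P.IsEmb P' e ∧
      ∀ s ∈ F, Function.Injective s →
        ∀ f g, P.IsCopyAt X s f → P.IsCopyAt X s g → α (e ∘ f) = α (e ∘ g) := by
  classical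
  induction F using Finset.induction_on generalizing P with
  | empty =>
    exact ⟨P, fun α => ⟨id, ⟨fun _ => rfl, fun _ _ => Iff.rfl⟩, by simp⟩⟩
  | insert s F _ ih =>
    by_cases hs : Function.Injective s
    · obtain ⟨P₁, h₁⟩ := P.exists_ramsey_at (κ := κ) X hs
      obtain ⟨P₂, h₂⟩ := ih P₁
      refine ⟨P₂, fun α => ?_⟩
      obtain ⟨e₂, he₂, hc₂⟩ := h₂ α
      obtain ⟨e₁, he₁, d, hd⟩ := h₁ fun f => α (e₂ ∘ f)
      refine ⟨e₂ ∘ e₁, he₂.comp he₁, fun s' hs' hinj f g hf hg => ?_⟩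
      rcases Finset.mem_insert.1 hs' with rfl | hs'
      · exact (hd f hf).trans (hd g hg).symm
      · exact hc₂ s' hs' hinj _ _ (hf.comp he₁) (hg.comp he₁)
    · obtain ⟨P', h⟩ := ih P
      refine ⟨P', fun α => ?_⟩
      obtain ⟨e, he, hc⟩ := h α
      refine ⟨e, he, fun s' hs' hinj => ?_⟩
      rcases Finset.mem_insert.1 hs' with rfl | hs'
      · exact absurd hinj hs
      · exact hc s' hs' hinj

end LabelledGraph

/-- A finite type can be enumerated compatibly with a map to a linear order. -/
theorem exists_equiv_fin_of_lt {V K : Type*} [Finite V] [LinearOrder K] (key : V → K) :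
    ∃ (c : ℕ) (φ : V ≃ Fin c), ∀ u v, key u < key v → φ u < φ v := by
  obtain ⟨c, ⟨ψ⟩⟩ := Finite.exists_equiv_fin V
  refine ⟨c, ψ.trans (Tuple.sort (key ∘ ψ.symm)).symm, fun u v h => ?_⟩
  by_contra! hle
  have := Tuple.monotone_sort (key ∘ ψ.symm) hle
  simp at this
  exact absurd h this.not_gt

/-- The disjoint union of copies of a properly colored graph `Y`, one at each position
`t : Fin b → Fin p`. -/
def LabelledGraph.ofCopies {n b : ℕ} (Y : SimpleGraph (Fin b)) (lamY : Fin b → Fin n)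
    (hY : ProperCol Y lamY) (p : ℕ) : LabelledGraph (Prod.snd : Fin p × Fin n → Fin n) where
  V := (Fin b → Fin p) × Fin b
  finite := inferInstance
  graph :=
    { Adj := fun x y => x.1 = y.1 ∧ Y.Adj x.2 y.2
      symm := ⟨fun _ _ h => ⟨h.1.symm, h.2.symm⟩⟩
      loopless := ⟨fun _ h => h.2.ne rfl⟩ }
  label := fun x => (x.1 x.2, lamY x.2)
  proper := fun _ _ h => hY _ _ h.2

/-- the class `K^<_n` of finite ordered `[n]`-colored graphs has the
Ramsey property. -/
theorem stmt_2 (n : ℕ) (hn : 1 ≤ n) (a b : ℕ)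
    (X : SimpleGraph (Fin a)) (lamX : Fin a → Fin n) (hX : ProperCol X lamX)
    (Y : SimpleGraph (Fin b)) (lamY : Fin b → Fin n) (hY : ProperCol Y lamY)
    (k : ℕ) :
    ∃ (c : ℕ) (Z : SimpleGraph (Fin c)) (lamZ : Fin c → Fin n),
      ProperCol Z lamZ ∧
      ∀ α : (Fin a → Fin c) → Fin k,
        ∃ e : Fin b → Fin c, ColOrdEmb Y lamY Z lamZ e ∧
          ∀ f g : Fin a → Fin b, ColOrdEmb X lamX Y lamY f →
            ColOrdEmb X lamX Y lamY g → α (e ∘ f) = α (e ∘ g) := by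
  obtain ⟨p, hp⟩ := exists_ramsey_number (Option (Fin k)) a b
  let P := LabelledGraph.ofCopies Y lamY hY p
  obtain ⟨P', hP'⟩ := P.exists_ramsey_of_finset (κ := Fin k) X Finset.univ
  have := P'.finite
  obtain ⟨c, φ, hφ⟩ := exists_equiv_fin_of_lt fun v => (P'.label v).1
  refine ⟨c, P'.graph.comap φ.symm, fun x => (P'.label (φ.symm x)).2,
    fun _ _ h => P'.proper _ _ h, fun α => ?_⟩
  obtain ⟨e, he, hcol⟩ := hP' fun f => α (φ ∘ f)
  have hpos : ∀ S : Finset (Fin p), ∃ d : Option (Fin k), ∀ s : Fin a → Fin p, StrictMono s →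
      Finset.univ.image s = S → ∀ f, P.IsCopyAt X (fun i => (s i, lamX i)) f →
        some (α (φ ∘ (e ∘ f))) = d := by
    intro S
    by_cases hS : ∃ s : Fin a → Fin p, StrictMono s ∧ Finset.univ.image s = S ∧
      ∃ f, P.IsCopyAt X (fun i => (s i, lamX i)) f
    · obtain ⟨s, hs, rfl, f, hf⟩ := hS
      refine ⟨some (α (φ ∘ (e ∘ f))), fun s' hs' himg g hg => ?_⟩
      have hss : s' = s := by
        refine (hs'.range_inj hs).1 ?_
        simpa using congrArg (fun F : Finset (Fin p) => (F : Set (Fin p))) himg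
      subst hss
      exact congrArg some (hcol _ (Finset.mem_univ _)
        (fun i j h => hs.injective (congrArg Prod.fst h)) g f hg hf)
    · exact ⟨none, fun s hs himg f hf => absurd ⟨s, hs, himg, f, hf⟩ hS⟩
  choose γ hγ using hpos
  obtain ⟨T, hT, d, hd⟩ := hp γ
  let t := T.orderEmbOfFin hT
  have ht : StrictMono t := t.strictMono
  have hlab : ∀ i, P'.label (e (t, i)) = (t i, lamY i) := fun i => he.1 (t, i)
  have key : ∀ f, ColOrdEmb X lamX Y lamY f → some (α ((fun i => φ (e (t, i))) ∘ f)) = d := by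
    rintro f ⟨⟨hmono, hadj⟩, hlam⟩
    have hsm : StrictMono (t ∘ f) := ht.comp hmono
    rw [← hd (Finset.univ.image (t ∘ f)) ?_ ?_]
    · refine hγ _ (t ∘ f) hsm rfl (fun i => (t, f i)) ⟨fun i => ?_, fun i j => ?_⟩
      · exact Prod.ext rfl (hlam i)
      · exact (and_iff_right rfl).trans (hadj i j)
    · intro x hx
      obtain ⟨i, -, rfl⟩ := Finset.mem_image.1 hx
      exact T.orderEmbOfFin_mem hT (f i)
    · rw [Finset.card_image_of_injective _ hsm.injective, Finset.card_fin]
  refine ⟨fun i => φ (e (t, i)), ⟨⟨fun i j hij => hφ _ _ ?_, fun i j => ?_⟩, fun i => ?_⟩,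
    fun f g hf hg => Option.some_injective _ ((key f hf).trans (key g hg).symm)⟩
  · simp only [hlab]
    exact ht hij
  · simp only [SimpleGraph.comap_adj, Equiv.symm_apply_apply]
    exact (he.2 _ _).trans (and_iff_right rfl)
  · simp only [Equiv.symm_apply_apply, hlab]
end

section
/- Fix an integer n ≥ 1. Every element X of the class C^<_n of all finite ordered n-colorable graphs has a finite Ramsey degree in C^<_n equal to σ(X), the number of non-isomorphic extensions of X in K^<_n. That is: σ(X) is the least natural number t such that for every Y ∈ C^<_n and every k ∈ ℕ there exists Z ∈ C^<_n such that for every map α from the copies of X in Z to {1,…,k} there is a copy Ỹ of Y in Z such that α takes at most t values on the copies of X in Ỹ. -/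
/-- **Finite Ramsey theorem** for `a`-element subsets of a linear order. -/
theorem exists_finset_card_eq_monochromatic (κ : Type) [Finite κ] [Nonempty κ] (a : ℕ) :
    ∀ b : ℕ, ∃ p : ℕ, ∀ {α : Type} [LinearOrder α] (S : Finset α), p ≤ S.card →
      ∀ c : Finset α → κ, ∃ T ⊆ S, T.card = b ∧
        ∃ col, ∀ U ⊆ T, U.card = a → c U = col := by
  induction a with
  | zero =>
    refine fun b => ⟨b, fun {α} _ S hS c => ?_⟩
    obtain ⟨T, hTS, hT⟩ := Finset.exists_subset_card_eq hS
    exact ⟨T, hTS, hT, c ∅, fun U _ hU => by rw [Finset.card_eq_zero.1 hU]⟩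
  | succ a ih =>
    have endHomogeneous : ∀ m : ℕ, ∃ p : ℕ, ∀ {α : Type} [LinearOrder α] (S : Finset α),
        p ≤ S.card → ∀ c : Finset α → κ, ∃ T ⊆ S, T.card = m ∧ ∃ g : α → κ,
          ∀ x ∈ T, ∀ U ⊆ T, U.card = a → (∀ y ∈ U, x < y) → c (insert x U) = g x := by
      intro m
      induction m with
      | zero =>
        exact ⟨0, fun S _ c => ⟨∅, by simp, rfl, fun _ => c ∅, by simp⟩⟩
      | succ m ihm =>
        obtain ⟨q, hq⟩ := ihm
        obtain ⟨r, hr⟩ := ih q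
        refine ⟨r + 1, fun {α} _ S hS c => ?_⟩
        have hne : S.Nonempty := Finset.card_pos.1 (by omega)
        set x := S.min' hne with hx
        have hxS : x ∈ S := S.min'_mem hne
        obtain ⟨T', hT'S, hT', col, hcol⟩ := hr (S.erase x)
          (by rw [Finset.card_erase_of_mem hxS]; omega) (fun U => c (insert x U))
        obtain ⟨T, hTT', hT, g, hg⟩ := hq T' hT'.ge c
        have hxT : x ∉ T := fun h => by simpa using hT'S (hTT' h)
        have hlt : ∀ y ∈ T, x < y := fun y hy => by
          have h := Finset.mem_erase.1 (hT'S (hTT' hy))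
          exact lt_of_le_of_ne (S.min'_le y h.2) h.1.symm
        have hsub : ∀ U ⊆ insert x T, x ∉ U → U ⊆ T := fun U hU hxU =>
          (Finset.subset_insert_iff_of_notMem hxU).1 hU
        refine ⟨insert x T, ?_, by rw [Finset.card_insert_of_notMem hxT, hT],
          Function.update g x col, ?_⟩
        · exact Finset.insert_subset hxS
            ((hTT'.trans hT'S).trans (Finset.erase_subset _ _))
        · intro y hy U hU hUa hyU
          rcases Finset.mem_insert.1 hy with rfl | hy
          · rw [Function.update_self]
            exact hcol U ((hsub U hU fun h => lt_irrefl _ (hyU _ h)).trans hTT') hUa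
          · rw [Function.update_of_ne (hlt y hy).ne']
            exact hg y hy U (hsub U hU fun h => lt_asymm (hyU _ h) (hlt y hy)) hUa hyU
    intro b
    have := Fintype.ofFinite κ
    classical
    obtain ⟨p, hp⟩ := endHomogeneous (Fintype.card κ * b)
    refine ⟨p, fun {α} _ S hS c => ?_⟩
    obtain ⟨T, hTS, hT, g, hg⟩ := hp S hS c
    obtain ⟨col, -, hcol⟩ := Finset.exists_le_card_fiber_of_mul_le_card_of_maps_to
      (s := T) (t := Finset.univ) (f := g) (n := b) (fun _ _ => Finset.mem_univ _)
      Finset.univ_nonempty (by rw [Finset.card_univ, hT])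
    obtain ⟨T₂, hT₂, hcard⟩ := Finset.exists_subset_card_eq hcol
    have hT₂T : T₂ ⊆ T := hT₂.trans (Finset.filter_subset _ _)
    refine ⟨T₂, hT₂T.trans hTS, hcard, col, fun U hU hUa => ?_⟩
    have hne : U.Nonempty := Finset.card_pos.1 (by omega)
    have hmem : U.min' hne ∈ U := U.min'_mem hne
    rw [← Finset.insert_erase hmem,
      hg _ (hT₂T (hU hmem)) _ ((Finset.erase_subset _ _).trans (hU.trans hT₂T))
        (by rw [Finset.card_erase_of_mem hmem, hUa]; rfl)
        (fun y hy => U.min'_lt_of_mem_erase_min' hne hy)]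
    exact (Finset.mem_filter.1 (hT₂ (hU hmem))).2

/-- **Finite Ramsey theorem**, phrased with strictly monotone maps. -/
theorem exists_strictMono_monochromatic (κ : Type) [Finite κ] [Nonempty κ] (a b : ℕ) :
    ∃ p : ℕ, ∀ c : (Fin a → Fin p) → κ, ∃ s : Fin b → Fin p, StrictMono s ∧
      ∃ col, ∀ f : Fin a → Fin b, StrictMono f → c (s ∘ f) = col := by
  classical
  obtain ⟨p, hp⟩ := exists_finset_card_eq_monochromatic κ a b
  refine ⟨p, fun c => ?_⟩
  obtain ⟨T, -, hT, col, hcol⟩ := hp (Finset.univ : Finset (Fin p)) (by simp)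
    (fun U => if h : U.card = a then c (U.orderEmbOfFin h) else Classical.arbitrary κ)
  refine ⟨T.orderEmbOfFin hT, (T.orderEmbOfFin hT).strictMono, col, fun f hf => ?_⟩
  have hmono : StrictMono (T.orderEmbOfFin hT ∘ f) :=
    (T.orderEmbOfFin hT).strictMono.comp hf
  have hcard : (Finset.univ.image (T.orderEmbOfFin hT ∘ f)).card = a := by
    rw [Finset.card_image_of_injective _ hmono.injective, Finset.card_fin]
  rw [← hcol (Finset.univ.image (T.orderEmbOfFin hT ∘ f)) ?_ hcard, dif_pos hcard]
  · congr 1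
    exact Finset.orderEmbOfFin_unique hcard
      (fun i => Finset.mem_image_of_mem _ (Finset.mem_univ i)) hmono
  · intro x hx
    obtain ⟨i, -, rfl⟩ := Finset.mem_image.1 hx
    exact T.orderEmbOfFin_mem hT _

/-- A finite type can be enumerated so that the enumeration refines a given rank function. -/
theorem exists_equiv_fin_of_rank {V : Type} [Finite V] (r : V → ℕ) :
    ∃ (c : ℕ) (φ : V ≃ Fin c), ∀ u v, r u < r v → φ u < φ v := by
  have := Fintype.ofFinite V
  let key : V → ℕ ×ₗ Fin (Fintype.card V) := fun v => toLex (r v, Fintype.equivFin V v)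
  have hkey : Function.Injective key := fun u v h =>
    (Fintype.equivFin V).injective (congrArg (fun z => (ofLex z).2) h)
  let _ : LinearOrder V := LinearOrder.lift' key hkey
  refine ⟨_, (Fintype.orderIsoFinOfCardEq V rfl).symm.toEquiv, fun u v h => ?_⟩
  have huv : u < v := (Prod.Lex.toLex_lt_toLex.2 (Or.inl h) : key u < key v)
  exact (Fintype.orderIsoFinOfCardEq V rfl).symm.lt_iff_lt.2 huv

/-- A finite graph whose vertices are distributed into parts indexed by `I`, such that edges
only join vertices whose parts are related by `R`. -/
structure PartiteGraph {I : Type} (R : I → I → Prop) where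
  V : Type
  finite : Finite V
  graph : SimpleGraph V
  part : V → I
  part_rel : ∀ u v, graph.Adj u v → R (part u) (part v)

namespace PartiteGraph

variable {I : Type} {R : I → I → Prop} {A : Type}

/-- Part-preserving maps which preserve and reflect adjacency. -/
def IsEmb (P Q : PartiteGraph R) (e : P.V → Q.V) : Prop :=
  (∀ v, Q.part (e v) = P.part v) ∧ ∀ u v, Q.graph.Adj (e u) (e v) ↔ P.graph.Adj u v

/-- `g` is a copy of `X` in `P` whose vertices lie in the parts prescribed by `ρ`. -/
def IsCopyOver (X : SimpleGraph A) (ρ : A → I) (P : PartiteGraph R) (g : A → P.V) : Prop :=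
  (∀ x, P.part (g x) = ρ x) ∧ ∀ x y, P.graph.Adj (g x) (g y) ↔ X.Adj x y

theorem IsCopyOver.comp {X : SimpleGraph A} {ρ : A → I} {P Q : PartiteGraph R} {g : A → P.V}
    (hg : IsCopyOver X ρ P g) {e : P.V → Q.V} (he : IsEmb P Q e) :
    IsCopyOver X ρ Q (e ∘ g) :=
  ⟨fun x => (he.1 _).trans (hg.1 x), fun x y => (he.2 _ _).trans (hg.2 x y)⟩

/-- The copies of `X` in `P` over `ρ`, used as letters for the Hales-Jewett theorem. -/
abbrev Letter (X : SimpleGraph A) (ρ : A → I) (P : PartiteGraph R) : Type :=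
  {g : A → P.V // IsCopyOver X ρ P g}

/-- Vertices of the power of `P`: words over the parts met by `ρ`, and for each line a copy of
the vertices in the other parts. -/
abbrev PowerVertex (X : SimpleGraph A) (ρ : A → I) (P : PartiteGraph R) (N : Type) : Type :=
  (A × (N → P.V)) ⊕ ((N → Option (Letter X ρ P)) × P.V)

variable {X : SimpleGraph A} {ρ : A → I} {P : PartiteGraph R} {N : Type}

open Classical in
/-- The embedding of `P` into its power along a combinatorial line. -/
noncomputable def lineEmb (l : Combinatorics.Line (Letter X ρ P) N) (u : P.V) :
    PowerVertex X ρ P N :=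
  if h : ∃ x, ρ x = P.part u then
    Sum.inl (h.choose, fun m => (l.idxFun m).elim u fun g => g.1 h.choose)
  else Sum.inr (l.idxFun, u)

theorem lineEmb_of_eq (hρ : Function.Injective ρ) (l : Combinatorics.Line (Letter X ρ P) N)
    {u : P.V} {x : A} (h : ρ x = P.part u) :
    lineEmb l u = Sum.inl (x, fun m => (l.idxFun m).elim u fun g => g.1 x) := by
  have hex : ∃ x, ρ x = P.part u := ⟨x, h⟩
  have hc : hex.choose = x := hρ (hex.choose_spec.trans h.symm)
  rw [lineEmb, dif_pos hex, hc]

theorem lineEmb_of_ne (l : Combinatorics.Line (Letter X ρ P) N) {u : P.V}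
    (h : ¬ ∃ x, ρ x = P.part u) : lineEmb l u = Sum.inr (l.idxFun, u) :=
  dif_neg h

/-- The part of a vertex of the power. -/
def powerPart : PowerVertex X ρ P N → I :=
  Sum.elim (fun w => ρ w.1) fun w => P.part w.2

theorem powerPart_lineEmb (hρ : Function.Injective ρ)
    (l : Combinatorics.Line (Letter X ρ P) N) (u : P.V) :
    powerPart (lineEmb l u) = P.part u := by
  by_cases h : ∃ x, ρ x = P.part u
  · obtain ⟨x, hx⟩ := h
    rw [lineEmb_of_eq hρ l hx]
    exact hx
  · rw [lineEmb_of_ne l h]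
    rfl

theorem lineEmb_injective (hρ : Function.Injective ρ)
    (l : Combinatorics.Line (Letter X ρ P) N) : Function.Injective (lineEmb l) := by
  intro u v huv
  have hpart : P.part u = P.part v := by
    rw [← powerPart_lineEmb hρ l u, huv, powerPart_lineEmb hρ l v]
  by_cases h : ∃ x, ρ x = P.part u
  · obtain ⟨x, hx⟩ := h
    obtain ⟨m, hm⟩ := l.proper
    rw [lineEmb_of_eq hρ l hx, lineEmb_of_eq hρ l (hx.trans hpart)] at huv
    simpa [hm] using congrFun (congrArg Prod.snd (Sum.inl_injective huv)) m
  · rw [lineEmb_of_ne l h, lineEmb_of_ne l (hpart ▸ h)] at huv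
    exact congrArg Prod.snd (Sum.inr_injective huv)

/-- Adjacency is the same along any two lines, for edges with an end in a part not met by `ρ`. -/
theorem adj_of_lineEmb_eq_of_ne (hρ : Function.Injective ρ)
    {l l' : Combinatorics.Line (Letter X ρ P) N} {u v u' v' : P.V}
    (hu : lineEmb l u = lineEmb l' u') (hv : lineEmb l v = lineEmb l' v')
    (h : ¬ ∃ x, ρ x = P.part u) (huv : P.graph.Adj u v) : P.graph.Adj u' v' := by
  have hpart : P.part u = P.part u' := by
    rw [← powerPart_lineEmb hρ l u, hu, powerPart_lineEmb hρ l' u']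
  have hu₀ := hu
  rw [lineEmb_of_ne l h, lineEmb_of_ne l' (hpart ▸ h)] at hu₀
  have hl : l = l' := by
    cases l; cases l'
    congr 1
    exact congrArg Prod.fst (Sum.inr_injective hu₀)
  subst hl
  rwa [← lineEmb_injective hρ l hu, ← lineEmb_injective hρ l hv]

theorem adj_of_lineEmb_eq (hρ : Function.Injective ρ)
    {l l' : Combinatorics.Line (Letter X ρ P) N} {u v u' v' : P.V}
    (hu : lineEmb l u = lineEmb l' u') (hv : lineEmb l v = lineEmb l' v')
    (huv : P.graph.Adj u v) : P.graph.Adj u' v' := by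
  by_cases hx : ∃ x, ρ x = P.part u
  swap
  · exact adj_of_lineEmb_eq_of_ne hρ hu hv hx huv
  by_cases hy : ∃ y, ρ y = P.part v
  swap
  · exact (adj_of_lineEmb_eq_of_ne hρ hv hu hy huv.symm).symm
  obtain ⟨x, hx⟩ := hx
  obtain ⟨y, hy⟩ := hy
  have hx' : ρ x = P.part u' := by
    rw [hx, ← powerPart_lineEmb hρ l u, hu, powerPart_lineEmb hρ l' u']
  have hy' : ρ y = P.part v' := by
    rw [hy, ← powerPart_lineEmb hρ l v, hv, powerPart_lineEmb hρ l' v']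
  rw [lineEmb_of_eq hρ l hx, lineEmb_of_eq hρ l' hx'] at hu
  rw [lineEmb_of_eq hρ l hy, lineEmb_of_eq hρ l' hy'] at hv
  replace hu := congrFun (congrArg Prod.snd (Sum.inl_injective hu))
  replace hv := congrFun (congrArg Prod.snd (Sum.inl_injective hv))
  dsimp only at hu hv
  by_cases hxy : X.Adj x y
  · obtain ⟨m, hm⟩ := l'.proper
    have hum := hu m
    have hvm := hv m
    rw [hm] at hum hvm
    rcases hlm : l.idxFun m with _ | g <;> rw [hlm] at hum hvm
    · change u = u' at hum
      change v = v' at hvm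
      rwa [← hum, ← hvm]
    · change g.1 x = u' at hum
      change g.1 y = v' at hvm
      rw [← hum, ← hvm]
      exact (g.2.2 x y).2 hxy
  · obtain ⟨m, hm⟩ := l.proper
    have hum := hu m
    have hvm := hv m
    rw [hm] at hum hvm
    rcases hlm : l'.idxFun m with _ | g <;> rw [hlm] at hum hvm
    · change u = u' at hum
      change v = v' at hvm
      rwa [← hum, ← hvm]
    · change u = g.1 x at hum
      change v = g.1 y at hvm
      rw [hum, hvm] at huv
      exact absurd ((g.2.2 x y).1 huv) hxy

/-- The power of `P`: the union of the copies of `P` along all combinatorial lines. -/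
def power [Finite A] (X : SimpleGraph A) (hρ : Function.Injective ρ) (P : PartiteGraph R)
    (N : Type) [Finite N] : PartiteGraph R where
  V := PowerVertex X ρ P N
  finite := by have := P.finite; infer_instance
  graph :=
    { Adj := fun s t => ∃ (l : Combinatorics.Line (Letter X ρ P) N) (u v : P.V),
        lineEmb l u = s ∧ lineEmb l v = t ∧ P.graph.Adj u v
      symm := ⟨fun _ _ ⟨l, u, v, hu, hv, h⟩ => ⟨l, v, u, hv, hu, h.symm⟩⟩
      loopless := ⟨fun _ ⟨l, _, _, hu, hv, h⟩ =>
        h.ne (lineEmb_injective hρ l (hu.trans hv.symm))⟩ }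
  part := powerPart
  part_rel := by
    rintro _ _ ⟨l, u, v, rfl, rfl, h⟩
    rw [powerPart_lineEmb hρ, powerPart_lineEmb hρ]
    exact P.part_rel u v h

theorem isEmb_lineEmb [Finite A] [Finite N] (hρ : Function.Injective ρ)
    (l : Combinatorics.Line (Letter X ρ P) N) : IsEmb P (power X hρ P N) (lineEmb l) :=
  ⟨powerPart_lineEmb hρ l, fun u v =>
    ⟨fun ⟨_, _, _, hu, hv, h⟩ => adj_of_lineEmb_eq hρ hu hv h, fun h => ⟨l, u, v, rfl, rfl, h⟩⟩⟩

/-- **Partite lemma**. -/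
theorem exists_partite_ramsey [Finite A] (X : SimpleGraph A) (hρ : Function.Injective ρ)
    (P : PartiteGraph R) (κ : Type) [Finite κ] :
    ∃ Q : PartiteGraph R, ∀ α : (A → Q.V) → κ, ∃ e, IsEmb P Q e ∧
      ∀ g g', IsCopyOver X ρ P g → IsCopyOver X ρ P g' → α (e ∘ g) = α (e ∘ g') := by
  have := P.finite
  obtain ⟨N, _, hN⟩ := Combinatorics.Line.exists_mono_in_high_dimension (Letter X ρ P) κ
  refine ⟨power X hρ P N, fun α => ?_⟩
  obtain ⟨l, c, hc⟩ := hN fun w => α fun x => Sum.inl (x, fun m => (w m).1 x)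
  have key : ∀ g, IsCopyOver X ρ P g → α (lineEmb l ∘ g) = c := by
    intro g hg
    rw [← hc ⟨g, hg⟩]
    congr 1
    funext x
    refine (lineEmb_of_eq hρ l (hg.1 x).symm).trans ?_
    congr 2
    funext m
    rw [Combinatorics.Line.coe_apply]
    cases l.idxFun m <;> rfl
  exact ⟨lineEmb l, isEmb_lineEmb hρ l, fun g g' hg hg' => (key g hg).trans (key g' hg').symm⟩

/-- **Partite construction**: the partite lemma applied successively to a list of prescriptions
of parts. -/
theorem exists_partite_ramsey_list [Finite A] (X : SimpleGraph A) (κ : Type) [Finite κ]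
    (L : List (A → I)) (hL : ∀ ρ ∈ L, Function.Injective ρ) (P : PartiteGraph R) :
    ∃ Q : PartiteGraph R, ∀ α : (A → Q.V) → κ, ∃ e, IsEmb P Q e ∧ ∀ ρ ∈ L,
      ∀ g g', IsCopyOver X ρ P g → IsCopyOver X ρ P g' → α (e ∘ g) = α (e ∘ g') := by
  induction L generalizing P with
  | nil => exact ⟨P, fun _ => ⟨id, ⟨fun _ => rfl, fun _ _ => Iff.rfl⟩, by simp⟩⟩
  | cons ρ L ih =>
    obtain ⟨P₁, h₁⟩ := exists_partite_ramsey X (hL ρ (by simp)) P κ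
    obtain ⟨Q, hQ⟩ := ih (fun σ hσ => hL σ (by simp [hσ])) P₁
    refine ⟨Q, fun α => ?_⟩
    obtain ⟨e, he, heL⟩ := hQ α
    obtain ⟨e₁, he₁, heρ⟩ := h₁ fun g => α (e ∘ g)
    refine ⟨e ∘ e₁, ⟨fun v => (he.1 _).trans (he₁.1 v),
      fun u v => (he.2 _ _).trans (he₁.2 u v)⟩, fun σ hσ g g' hg hg' => ?_⟩
    rcases List.mem_cons.1 hσ with rfl | hσ
    · exact heρ g g' hg hg'
    · exact heL σ hσ _ _ (hg.comp he₁) (hg'.comp he₁)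

end PartiteGraph

theorem OrdEmb.comp {a b c : ℕ} {X : SimpleGraph (Fin a)} {Y : SimpleGraph (Fin b)}
    {Z : SimpleGraph (Fin c)} {e : Fin b → Fin c} {f : Fin a → Fin b} (he : OrdEmb Y Z e)
    (hf : OrdEmb X Y f) : OrdEmb X Z (e ∘ f) :=
  ⟨he.1.comp hf.1, fun i j => (he.2 _ _).trans (hf.2 i j)⟩

theorem ProperCol.comp_ordEmb {a b n : ℕ} {X : SimpleGraph (Fin a)} {Y : SimpleGraph (Fin b)}
    {mu : Fin b → Fin n} (hmu : ProperCol Y mu) {f : Fin a → Fin b} (hf : OrdEmb X Y f) :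
    ProperCol X (mu ∘ f) :=
  fun i j h => hmu _ _ ((hf.2 i j).2 h)

theorem SimpleGraph.Colorable.exists_properCol {a n : ℕ} {X : SimpleGraph (Fin a)}
    (hX : X.Colorable n) : ∃ lam : Fin a → Fin n, ProperCol X lam :=
  hX.elim fun C => ⟨C, fun _ _ h => C.valid h⟩

open PartiteGraph in
/-- Ordered `[n]`-colored graphs have the Ramsey property, simultaneously for all proper
colorings of `X`: the color of a copy of `X` in the copy of `Y` depends only on the coloring
induced on it by `mu`. -/
theorem exists_colored_ramsey {n a b k : ℕ} (hk : 0 < k) (X : SimpleGraph (Fin a))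
    (Y : SimpleGraph (Fin b)) (mu : Fin b → Fin n) (hmu : ProperCol Y mu) :
    ∃ (c : ℕ) (Z : SimpleGraph (Fin c)), Z.Colorable n ∧ ∀ α : (Fin a → Fin c) → Fin k,
      ∃ e : Fin b → Fin c, OrdEmb Y Z e ∧ ∃ col : (Fin a → Fin n) → Fin k,
        ∀ f : Fin a → Fin b, OrdEmb X Y f → α (e ∘ f) = col (mu ∘ f) := by
  classical
  have : Nonempty (Fin k) := ⟨⟨0, hk⟩⟩
  obtain ⟨p, hp⟩ := exists_strictMono_monochromatic ((Fin a → Fin n) → Fin k) a b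
  -- The disjoint union of copies of `Y`, one over each `b`-subset of `Fin p`.
  let P : PartiteGraph (fun s t : Fin p × Fin n => s.2 ≠ t.2) :=
    { V := (Fin b → Fin p) × Fin b
      finite := inferInstance
      graph :=
        { Adj := fun u v => u.1 = v.1 ∧ Y.Adj u.2 v.2
          symm := ⟨fun _ _ h => ⟨h.1.symm, h.2.symm⟩⟩
          loopless := ⟨fun _ h => h.2.ne rfl⟩ }
      part := fun u => (u.1 u.2, mu u.2)
      part_rel := fun u v h => hmu _ _ h.2 }
  let L : List (Fin a → Fin p × Fin n) :=
    (Finset.univ.filter fun ρ : Fin a → Fin p × Fin n => Function.Injective ρ).toList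
  obtain ⟨Q, hQ⟩ := exists_partite_ramsey_list X (Fin k) L (fun ρ hρ => by simpa [L] using hρ) P
  have := Q.finite
  obtain ⟨c, φ, hφ⟩ := exists_equiv_fin_of_rank fun v : Q.V => ((Q.part v).1 : ℕ)
  refine ⟨c, Q.graph.comap φ.symm, ⟨SimpleGraph.Coloring.mk
    (fun v => (Q.part (φ.symm v)).2) fun {u v} h => Q.part_rel _ _ h⟩, fun α => ?_⟩
  obtain ⟨e, he, heL⟩ := hQ fun g => α (φ ∘ g)
  let copyAt (ι : Fin a → Fin p) (lam : Fin a → Fin n) (g : Fin a → P.V) : Prop :=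
    IsCopyOver X (fun x => (ι x, lam x)) P g
  obtain ⟨s, hs, col, hcol⟩ := hp fun ι lam =>
    if h : ∃ g, copyAt ι lam g then α (φ ∘ e ∘ h.choose) else Classical.arbitrary (Fin k)
  refine ⟨fun v => φ (e (s, v)), ⟨fun u v huv => hφ _ _ ?_, fun u v => ?_⟩, col, fun f hf => ?_⟩
  · rw [he.1, he.1]
    exact hs huv
  · simp only [SimpleGraph.comap_adj, Equiv.symm_apply_apply]
    rw [he.2]
    exact and_iff_right rfl
  · have hg : copyAt (s ∘ f) (mu ∘ f) fun x => (s, f x) :=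
      ⟨fun _ => rfl, fun x y => (and_iff_right rfl).trans (hf.2 x y)⟩
    have hex : ∃ g, copyAt (s ∘ f) (mu ∘ f) g := ⟨_, hg⟩
    rw [← hcol f hf.1]
    dsimp only
    rw [dif_pos hex]
    refine heL (fun x => ((s ∘ f) x, (mu ∘ f) x)) ?_ _ _ hg hex.choose_spec
    simp only [L, Finset.mem_toList, Finset.mem_filter, Finset.mem_univ, true_and]
    exact fun x y h => (hs.comp hf.1).injective (congrArg Prod.fst h)

/-- There is an ordered `n`-colorable graph every proper coloring of which induces every proper
coloring of `X` on some copy of `X`. -/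
theorem exists_forcing_all_colorings (n a : ℕ) (X : SimpleGraph (Fin a)) :
    ∃ (b : ℕ) (Y : SimpleGraph (Fin b)), Y.Colorable n ∧ ∀ mu : Fin b → Fin n, ProperCol Y mu →
      ∀ lam : Fin a → Fin n, ProperCol X lam → ∃ f, OrdEmb X Y f ∧ mu ∘ f = lam := by
  -- All colored versions of `X`, with a clique joined to them so as to force the colors.
  let W := ({lam : Fin a → Fin n // ProperCol X lam} × Fin a) ⊕ Fin n
  let color : W → Fin n := Sum.elim (fun w => w.1.1 w.2) id
  let G : SimpleGraph W :=
    { Adj := fun u v => color u ≠ color v ∧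
        ∀ w w', u = Sum.inl w → v = Sum.inl w' → w.1 = w'.1 ∧ X.Adj w.2 w'.2
      symm := ⟨fun u v h => ⟨h.1.symm, fun w w' hw hw' =>
        ⟨(h.2 w' w hw' hw).1.symm, (h.2 w' w hw' hw).2.symm⟩⟩⟩
      loopless := ⟨fun u h => h.1 rfl⟩ }
  obtain ⟨b, φ, hφ⟩ := exists_equiv_fin_of_rank
    (Sum.elim (fun w => (w.2 : ℕ)) fun _ => 0 : W → ℕ)
  refine ⟨b, G.comap φ.symm, ⟨SimpleGraph.Coloring.mk
    (fun v => color (φ.symm v)) fun {u v} h => h.1⟩, fun mu hmu lam hlam => ?_⟩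
  have hne : ∀ u v : W, G.Adj u v → mu (φ u) ≠ mu (φ v) := fun u v h =>
    hmu _ _ (by simpa using h)
  let perm : Fin n → Fin n := fun q => mu (φ (Sum.inr q))
  have hinj : Function.Injective perm := fun q q' h => by
    by_contra hqq
    exact hne (Sum.inr q) (Sum.inr q') ⟨hqq, by simp⟩ h
  have hbij : Function.Bijective perm := Finite.injective_iff_bijective.1 hinj
  have hforced : ∀ w, mu (φ (Sum.inl w)) = perm (w.1.1 w.2) := by
    intro w
    obtain ⟨q, hq⟩ := hbij.2 (mu (φ (Sum.inl w)))
    by_cases hqw : w.1.1 w.2 = q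
    · rw [hqw, hq]
    · exact absurd hq.symm (hne (Sum.inl w) (Sum.inr q) ⟨hqw, by simp⟩)
  let σ := Equiv.ofBijective perm hbij
  have hlam' : ProperCol X (σ.symm ∘ lam) := fun i j h h' =>
    hlam i j h (σ.symm.injective h')
  refine ⟨fun i => φ (Sum.inl (⟨_, hlam'⟩, i)), ⟨fun i j hij => hφ _ _ hij, fun i j => ?_⟩, ?_⟩
  · simp only [SimpleGraph.comap_adj, Equiv.symm_apply_apply]
    constructor
    · exact fun h => (h.2 _ _ rfl rfl).2
    · intro h
      refine ⟨hlam' i j h, fun w w' hw hw' => ?_⟩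
      obtain rfl := Sum.inl_injective hw
      obtain rfl := Sum.inl_injective hw'
      exact ⟨rfl, h⟩
  · funext i
    exact (hforced _).trans (σ.apply_symm_apply (lam i))

/-- every finite ordered `n`-colorable graph `X` has Ramsey degree in
`C^<_n` equal to `σ(X)`, the number of non-isomorphic extensions of `X` in `K^<_n`
(i.e. the number of proper `[n]`-colorings of `X`, since an ordered graph has no
non-trivial automorphisms). -/
theorem stmt_3 (n : ℕ) (hn : 1 ≤ n) (a : ℕ)
    (X : SimpleGraph (Fin a)) (hX : X.Colorable n) :
    IsLeast {t : ℕ |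
      ∀ (b : ℕ) (Y : SimpleGraph (Fin b)), Y.Colorable n →
        ∀ k : ℕ, ∃ (c : ℕ) (Z : SimpleGraph (Fin c)), Z.Colorable n ∧
          ∀ α : (Fin a → Fin c) → Fin k,
            ∃ e : Fin b → Fin c, OrdEmb Y Z e ∧
              ∃ V : Finset (Fin k), V.card ≤ t ∧
                ∀ f : Fin a → Fin b, OrdEmb X Y f → α (e ∘ f) ∈ V}
      (Nat.card {lam : Fin a → Fin n // ProperCol X lam}) := by
  classical
  constructor
  · intro b Y hY k
    rcases Nat.eq_zero_or_pos k with rfl | hk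
    · exact ⟨1, ⊥, ⟨SimpleGraph.Coloring.mk (fun _ => ⟨0, hn⟩) fun {_ _} h => h.elim⟩,
        fun α => (α fun _ => 0).elim0⟩
    obtain ⟨mu, hmu⟩ := hY.exists_properCol
    obtain ⟨c, Z, hZ, h⟩ := exists_colored_ramsey hk X Y mu hmu
    refine ⟨c, Z, hZ, fun α => ?_⟩
    obtain ⟨e, he, col, hcol⟩ := h α
    refine ⟨e, he, Finset.univ.image
      fun lam : {lam : Fin a → Fin n // ProperCol X lam} => col lam.1, ?_, fun f hf => ?_⟩
    · rw [Nat.card_eq_fintype_card]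
      exact Finset.card_image_le
    · rw [hcol f hf]
      exact Finset.mem_image_of_mem
        (fun lam : {lam : Fin a → Fin n // ProperCol X lam} => col lam.1)
        (Finset.mem_univ ⟨mu ∘ f, hmu.comp_ordEmb hf⟩)
  · intro t ht
    obtain ⟨b, Y, hY, hforce⟩ := exists_forcing_all_colorings n a X
    obtain ⟨c, Z, hZ, h⟩ := ht b Y hY (Fintype.card (Fin a → Fin n))
    obtain ⟨nu, hnu⟩ := hZ.exists_properCol
    let enc := Fintype.equivFin (Fin a → Fin n)
    obtain ⟨e, he, V, hV, hmem⟩ := h fun g => enc (nu ∘ g)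
    refine le_trans ?_ hV
    rw [Nat.card_eq_fintype_card, ← Finset.card_univ]
    refine Finset.card_le_card_of_injOn (fun lam => enc lam.1) (fun lam _ => ?_)
      (fun lam _ lam' _ hll => Subtype.ext (enc.injective hll))
    obtain ⟨f, hf, hfl⟩ := hforce (nu ∘ e) (hnu.comp_ordEmb he) lam.1 lam.2
    have := hmem f hf
    rwa [← Function.comp_assoc, hfl] at this
end

section
/- Fix an integer n ≥ 1 and let X be an element of the class C^<_n of all finite ordered n-colorable graphs. Then for every Y ∈ C^<_n and every k ∈ ℕ there exists Z ∈ C^<_n such that for every map α from the copies of X in Z to {1,…,k} there is a copy Ỹ of Y in Z such that α takes at most σ(X) values on the copies of X in Ỹ, where σ(X) is the number of non-isomorphic extensions of X in K^<_n. -/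
/-- Parameter words of length `N` over the alphabet `A` with `d` parameters: every parameter
occurs, and the first occurrences of the parameters appear in increasing order. After the first
occurrence of a parameter, that parameter is treated as an additional letter. -/
inductive PWord : Type → ℕ → ℕ → Type 1
  | nil {A : Type} : PWord A 0 0
  | letter {A : Type} {d N : ℕ} (a : A) (w : PWord A d N) : PWord A d (N + 1)
  | param {A : Type} {d N : ℕ} (w : PWord (Option A) d N) : PWord A (d + 1) (N + 1)

namespace PWord

/-- Apply a map to the letters of a parameter word. -/
def map {A : Type} {d N : ℕ} : PWord A d N → {B : Type} → (A → B) → PWord B d N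
  | nil, _, _ => nil
  | letter a w, _, σ => letter (σ a) (w.map σ)
  | param w, _, σ => param (w.map (Option.map σ))

/-- Apply `σ` to the letters of a parameter word with `m` parameters, and replace its parameters
by the entries of a parameter word of length `m`. -/
def subst {A : Type} {m N : ℕ} :
    PWord A m N → {B : Type} → {d : ℕ} → (A → B) → PWord B d m → PWord B d N
  | nil, _, _, _, f => f
  | letter a v, _, _, σ, f => letter (σ a) (v.subst σ f)
  | param v, _, _, σ, letter b f => letter b (v.subst (fun o => o.elim b σ) f)
  | param v, _, _, σ, param f => param (v.subst (Option.map σ) f)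

theorem subst_map {A : Type} {m N : ℕ} (v : PWord A m N) {B C : Type} {d : ℕ} (σ : A → B)
    (τ : B → C) (f : PWord C d m) : (v.map σ).subst τ f = v.subst (τ ∘ σ) f := by
  induction v generalizing B C d with
  | nil => rfl
  | letter a v ih => simp [map, subst, ih]
  | param v ih =>
    cases f with
    | letter b f =>
      simp only [map, subst, ih]
      congr 2
      funext o
      cases o <;> rfl
    | param f => simp [map, subst, ih]

theorem subst_subst {A : Type} {l N : ℕ} (u : PWord A l N) {B C : Type} {m d : ℕ} (σ : A → B)
    (τ : B → C) (v : PWord B m l) (f : PWord C d m) :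
    (u.subst σ v).subst τ f = u.subst (τ ∘ σ) (v.subst τ f) := by
  induction u generalizing B C m d with
  | nil => rfl
  | letter a u ih => simp [subst, ih]
  | param u ih =>
    cases v with
    | letter b v =>
      simp only [subst, ih]
      congr 2
      funext o
      cases o <;> rfl
    | param v =>
      cases f with
      | letter c f =>
        simp only [subst, ih]
        congr 2
        funext o
        cases o <;> rfl
      | param f => simp [subst, ih]

/-- Replace the parameters of a parameter word by the entries of another one. -/
def comp {A : Type} {m N d : ℕ} (v : PWord A m N) (f : PWord A d m) : PWord A d N :=
  v.subst id f

theorem comp_assoc {A : Type} {l N m d : ℕ} (u : PWord A l N) (v : PWord A m l)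
    (f : PWord A d m) : (u.comp v).comp f = u.comp (v.comp f) :=
  subst_subst u id id v f

/-- The letters of a parameter word before the first occurrence of a parameter. -/
def lead {A : Type} {d N : ℕ} : PWord A d N → List A
  | nil => []
  | letter a w => a :: w.lead
  | param _ => []

theorem length_lead_lt {A : Type} {d N : ℕ} (w : PWord A (d + 1) N) : w.lead.length < N := by
  generalize hd : d + 1 = d' at w
  induction w with
  | nil => omega
  | letter a w ih => simpa [lead] using ih hd
  | param w => simp [lead]

/-- Put the letters `x` in front of a parameter word. -/
def pre {A : Type} {d N : ℕ} : {n : ℕ} → (Fin n → A) → PWord A d N → PWord A d (N + n)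
  | 0, _, w => w
  | _ + 1, x, w => letter (x 0) (pre (fun i => x i.succ) w)

theorem pre_subst {A B : Type} {d m N n : ℕ} (x : Fin n → A) (w : PWord A m N) (σ : A → B)
    (f : PWord B d m) : (pre x w).subst σ f = pre (σ ∘ x) (w.subst σ f) := by
  induction n with
  | zero => rfl
  | succ n ih => simp only [pre, subst, ih]; rfl

theorem lead_pre {A : Type} {d N n : ℕ} (x : Fin n → A) (w : PWord A d N) :
    (pre x w).lead = List.ofFn x ++ w.lead := by
  induction n with
  | zero => simp [pre]
  | succ n ih => simp [pre, lead, ih]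

/-- The parameter word that starts with a combinatorial line and continues with `w`. -/
theorem exists_line_append {A : Type} {m N n : ℕ} (x : Fin n → Option A) (hx : ∃ i, x i = none)
    (w : PWord A m N) : ∃ W : PWord A (m + 1) (N + n),
      (∀ (d : ℕ) (a : A) (f : PWord A d m),
        W.comp (letter a f) = pre (fun i => (x i).getD a) (w.comp f)) ∧
      ∃ p : List A, ∀ (d : ℕ) (f : PWord (Option A) d m), (W.comp (param f)).lead = p := by
  induction n with
  | zero => exact hx.choose.elim0
  | succ n ih =>
    cases h : x 0 with
    | some b =>
      obtain ⟨i, hi⟩ := hx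
      obtain ⟨j, rfl⟩ : ∃ j : Fin n, i = j.succ :=
        Fin.exists_succ_eq.mpr (by rintro rfl; simp_all) |>.imp fun _ h => h.symm
      obtain ⟨W, hW, p, hp⟩ := ih (fun i => x i.succ) ⟨j, hi⟩
      refine ⟨letter b W, fun d a f => ?_, b :: p, fun d f => ?_⟩
      · have := hW d a f
        simp only [comp] at this ⊢
        simp only [subst, pre, this, h]
        rfl
      · have := hp d f
        simp only [comp] at this ⊢
        simp [subst, lead, this]
    | none =>
      refine ⟨param (pre (fun i => x i.succ) (w.map some)), fun d a f => ?_, [], fun d f => rfl⟩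
      simp only [comp, subst, pre_subst, subst_map, pre, h]
      congr 2
      funext i
      simp only [Function.comp]
      cases x i.succ <;> rfl

theorem exists_line (A : Type) [Finite A] (K : Type*) [Finite K] :
    ∃ n : ℕ, ∀ C : (Fin n → A) → K, ∃ x : Fin n → Option A, (∃ i, x i = none) ∧
      ∃ κ, ∀ a, C (fun i => (x i).getD a) = κ := by
  obtain ⟨ι, _, h⟩ := Combinatorics.Line.exists_mono_in_high_dimension A K
  refine ⟨Fintype.card ι, fun C => ?_⟩
  let e := Fintype.equivFin ι
  obtain ⟨l, κ, hκ⟩ := h fun y => C (y ∘ e.symm)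
  refine ⟨l.idxFun ∘ e.symm, ?_, κ, fun a => hκ a⟩
  obtain ⟨i, hi⟩ := l.proper
  exact ⟨e i, by simpa using hi⟩

instance finite_zero (A : Type) [Finite A] (N : ℕ) : Finite (PWord A 0 N) := by
  induction N with
  | zero =>
    have : Subsingleton (PWord A 0 0) := ⟨fun v w => by cases v; cases w; rfl⟩
    infer_instance
  | succ N ih =>
    refine Finite.of_surjective (fun q : A × PWord A 0 N => letter q.1 q.2) fun w => ?_
    cases w with
    | letter a w => exact ⟨(a, w), rfl⟩

/-- The multidimensional Hales–Jewett theorem for parameter words. -/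
theorem exists_mono_zero (A : Type) [Finite A] (K : Type) [Finite K] (m : ℕ) :
    ∃ N, ∀ χ : PWord A 0 N → K, ∃ w : PWord A m N, ∃ κ, ∀ f : PWord A 0 m,
      χ (w.comp f) = κ := by
  induction m with
  | zero =>
    refine ⟨0, fun χ => ⟨nil, χ nil, fun f => ?_⟩⟩
    cases f
    rfl
  | succ m ih =>
    obtain ⟨N, hN⟩ := ih
    obtain ⟨n, hn⟩ := exists_line A (PWord A 0 N → K)
    refine ⟨N + n, fun χ => ?_⟩
    obtain ⟨x, hx, χ', hχ'⟩ := hn fun x y => χ (pre x y)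
    obtain ⟨w, κ, hw⟩ := hN χ'
    obtain ⟨W, hW, -⟩ := exists_line_append x hx w
    refine ⟨W, κ, fun f => ?_⟩
    cases f with
    | letter a f =>
      rw [hW, ← hw f, ← hχ' a]

theorem exists_comp_eq_length_lead (A : Type) [Finite A] (K : Type) [Finite K] (d m : ℕ) :
    ∃ N, ∀ c : List A → K, ∃ w : PWord A m N, ∃ c' : ℕ → K, ∀ f : PWord A (d + 1) m,
      c (w.comp f).lead = c' f.lead.length := by
  induction m with
  | zero => exact ⟨0, fun c => ⟨nil, fun _ => c [], nofun⟩⟩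
  | succ m ih =>
    obtain ⟨N, hN⟩ := ih
    have : Finite {l : List A // l.length < N} := (List.finite_length_lt A N).to_subtype
    obtain ⟨n, hn⟩ := exists_line A ({l : List A // l.length < N} → K)
    refine ⟨N + n, fun c => ?_⟩
    obtain ⟨x, hx, F, hF⟩ := hn fun x l => c (List.ofFn x ++ l.1)
    obtain ⟨w, c', hw⟩ := hN fun l => if h : l.length < N then F ⟨l, h⟩ else c []
    obtain ⟨W, hW, p, hp⟩ := exists_line_append x hx w
    refine ⟨W, fun i => Nat.casesOn i (c p) c', fun f => ?_⟩
    cases f with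
    | letter a f =>
      have := hw f
      rw [dif_pos (length_lead_lt _), ← hF a] at this
      rw [hW, lead_pre]
      exact this
    | param f => rw [hp]; rfl

theorem exists_comp_length_lead_eq (A : Type) [Nonempty A] {K : Type} (c : ℕ → K) (κ : K)
    [DecidableEq K] (d m N : ℕ) (h : m ≤ ((Finset.range N).filter fun i => c i = κ).card) :
    ∃ w : PWord A m N, ∀ f : PWord A (d + 1) m, c (w.comp f).lead.length = κ := by
  obtain ⟨a₀⟩ := ‹Nonempty A›
  induction N generalizing c m with
  | zero =>
    obtain rfl : m = 0 := by simpa using h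
    exact ⟨nil, nofun⟩
  | succ N ih =>
    have key : ((Finset.range (N + 1)).filter fun i => c i = κ).card =
        ((Finset.range N).filter fun i => c (i + 1) = κ).card + if c 0 = κ then 1 else 0 := by
      simp only [Finset.card_filter]
      exact Finset.sum_range_succ' _ _
    rw [key] at h
    by_cases hm : m ≤ ((Finset.range N).filter fun i => c (i + 1) = κ).card
    · obtain ⟨w, hw⟩ := ih (fun i => c (i + 1)) m hm
      exact ⟨letter a₀ w, fun f => hw f⟩
    · have h0 : c 0 = κ := by
        by_contra h0
        simp [h0] at h
        omega
      obtain ⟨m, rfl⟩ : ∃ m', m = m' + 1 := ⟨m - 1, by omega⟩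
      obtain ⟨w, hw⟩ := ih (fun i => c (i + 1)) m (by simp [h0] at h; omega)
      refine ⟨param (w.map some), fun f => ?_⟩
      cases f with
      | letter a f =>
        simp only [comp, subst, subst_map, lead]
        exact hw f
      | param f => exact h0

/-- If the parameter words with `d` parameters have the Ramsey property over every alphabet, then
a coloring of the parameter words with `d + 1` parameters can be made to depend only on the letters
before the first parameter. -/
theorem exists_comp_eq_lead (d : ℕ)
    (hd : ∀ (A : Type) [Finite A] [Nonempty A] (K : Type) [Finite K] [Nonempty K] (m : ℕ),
      ∃ N, ∀ χ : PWord A d N → K, ∃ w : PWord A m N, ∃ κ, ∀ f : PWord A d m, χ (w.comp f) = κ)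
    (A : Type) [Finite A] [Nonempty A] (K : Type) [Finite K] [Nonempty K] (m : ℕ) :
    ∃ N, ∀ χ : PWord A (d + 1) N → K, ∃ w : PWord A m N, ∃ c : List A → K,
      ∀ f : PWord A (d + 1) m, χ (w.comp f) = c f.lead := by
  induction m generalizing K with
  | zero => exact ⟨0, fun χ => ⟨nil, fun _ => Classical.arbitrary K, nofun⟩⟩
  | succ m ih =>
    obtain ⟨N, hN⟩ := ih (A → K)
    obtain ⟨N', hN'⟩ := hd (Option A) K N
    refine ⟨N' + 1, fun χ => ?_⟩
    obtain ⟨v, κ, hv⟩ := hN' fun f => χ (param f)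
    obtain ⟨w, c, hw⟩ := hN fun f a => χ (letter a (v.subst (fun o => o.getD a) f))
    refine ⟨param (v.comp (w.map some)),
      fun l => List.casesOn l κ fun a l => c l a, fun f => ?_⟩
    cases f with
    | letter a f =>
      refine Eq.trans ?_ (congrFun (hw f) a)
      simp only [comp, subst, subst_subst, subst_map]
      congr 3
      funext o
      cases o <;> rfl
    | param f =>
      refine Eq.trans ?_ (hv (w.subst some f))
      simp only [comp, subst, subst_subst, subst_map, Option.map_id]
      rfl

/-- The Graham–Rothschild theorem for parameter words. -/
theorem exists_mono (d : ℕ) (A : Type) [Finite A] [Nonempty A] (K : Type) [Finite K] [Nonempty K]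
    (m : ℕ) : ∃ N, ∀ χ : PWord A d N → K, ∃ w : PWord A m N, ∃ κ, ∀ f : PWord A d m,
      χ (w.comp f) = κ := by
  classical
  induction d generalizing A K m with
  | zero => exact exists_mono_zero A K m
  | succ d ih =>
    have := Fintype.ofFinite K
    obtain ⟨N₂, h₂⟩ := exists_comp_eq_length_lead A K d (Fintype.card K * m)
    obtain ⟨N₁, h₁⟩ := exists_comp_eq_lead d ih A K N₂
    refine ⟨N₁, fun χ => ?_⟩
    obtain ⟨w₁, c₁, hw₁⟩ := h₁ χ
    obtain ⟨w₂, c₂, hw₂⟩ := h₂ c₁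
    obtain ⟨κ, -, hκ⟩ := Finset.exists_le_card_fiber_of_mul_le_card_of_maps_to
      (s := Finset.range (Fintype.card K * m)) (t := Finset.univ) (f := c₂) (n := m)
      (fun _ _ => Finset.mem_univ _) Finset.univ_nonempty (by simp)
    obtain ⟨w₃, hw₃⟩ := exists_comp_length_lead_eq A c₂ κ d m _ hκ
    refine ⟨w₁.comp (w₂.comp w₃), κ, fun f => ?_⟩
    rw [comp_assoc, comp_assoc, hw₁, hw₂, hw₃]

/-- Turn the letter `none` into the parameter `0`. -/
def shiftLetter {A : Type} {d : ℕ} : Option A ⊕ Fin d → A ⊕ Fin (d + 1)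
  | .inl (some a) => .inl a
  | .inl none => .inr 0
  | .inr j => .inr j.succ

/-- The entries of a parameter word. -/
def eval {A : Type} {d N : ℕ} : PWord A d N → Fin N → A ⊕ Fin d
  | nil => Fin.elim0
  | letter a w => Fin.cons (.inl a) w.eval
  | param w => Fin.cons (.inr 0) fun i => shiftLetter (w.eval i)

theorem eval_subst {A : Type} {m N : ℕ} (v : PWord A m N) {B : Type} {d : ℕ} (σ : A → B)
    (f : PWord B d m) (i : Fin N) :
    (v.subst σ f).eval i = Sum.elim (fun a => .inl (σ a)) f.eval (v.eval i) := by
  induction v generalizing B d with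
  | nil => exact i.elim0
  | letter a v ih =>
    cases i using Fin.cases with
    | zero => simp [subst, eval]
    | succ i => simp [subst, eval, ih]
  | param v ih =>
    cases f with
    | letter b f =>
      cases i using Fin.cases with
      | zero => simp [subst, eval]
      | succ i =>
        simp only [subst, eval, ih, Fin.cons_succ]
        rcases v.eval i with (_ | a) | j <;> simp [shiftLetter]
    | param f =>
      cases i using Fin.cases with
      | zero => simp [subst, eval]
      | succ i =>
        simp only [subst, eval, ih, Fin.cons_succ]
        rcases v.eval i with (_ | a) | j <;> simp [shiftLetter]

end PWord

/-- Every parameter occurs in `f`, and the first occurrences of the parameters are in increasing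
order. -/
def IsRigid {P Q A : Type} [LE P] [LE Q] (f : Q → A ⊕ P) : Prop :=
  ∀ p, ∃ q, f q = .inr p ∧ ∀ p' q', p ≤ p' → f q' = .inr p' → q ≤ q'

namespace PWord

theorem isRigid_eval {A : Type} {d N : ℕ} (w : PWord A d N) : IsRigid w.eval := by
  induction w with
  | nil => exact fun p => p.elim0
  | letter a w ih =>
    intro p
    obtain ⟨q, hq, h⟩ := ih p
    refine ⟨q.succ, by simpa [eval] using hq, fun p' q' hp hq' => ?_⟩
    cases q' using Fin.cases with
    | zero => simp [eval] at hq'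
    | succ q' => exact Fin.succ_le_succ_iff.mpr (h p' q' hp (by simpa [eval] using hq'))
  | param w ih =>
    intro p
    cases p using Fin.cases with
    | zero => exact ⟨0, by simp [eval], fun _ _ _ _ => Fin.zero_le _⟩
    | succ p =>
      obtain ⟨q, hq, h⟩ := ih p
      refine ⟨q.succ, by simp [eval, hq, shiftLetter], fun p' q' hp hq' => ?_⟩
      cases p' using Fin.cases with
      | zero => simp at hp
      | succ p' =>
        cases q' using Fin.cases with
        | zero => simp [eval, Fin.ext_iff] at hq'
        | succ q' =>
          refine Fin.succ_le_succ_iff.mpr (h p' q' (Fin.succ_le_succ_iff.mp hp) ?_)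
          simp only [eval, Fin.cons_succ] at hq'
          rcases hw : w.eval q' with (_ | a) | j
          · simp [hw, shiftLetter, Fin.ext_iff] at hq'
          · simp [hw, shiftLetter] at hq'
          · simpa [hw, shiftLetter] using hq'

theorem exists_eval_eq {A : Type} {d N : ℕ} (f : Fin N → A ⊕ Fin d) (hf : IsRigid f) :
    ∃ w : PWord A d N, w.eval = f := by
  induction N generalizing A d with
  | zero =>
    cases d with
    | zero => exact ⟨nil, funext fun i => i.elim0⟩
    | succ d => exact (hf 0).choose.elim0
  | succ N ih =>
    rcases h0 : f 0 with a | p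
    · obtain ⟨w, hw⟩ := ih (fun i => f i.succ) fun p => by
        obtain ⟨q, hq, h⟩ := hf p
        cases q using Fin.cases with
        | zero => simp [h0] at hq
        | succ q => exact ⟨q, hq, fun p' q' hp hq' => Fin.succ_le_succ_iff.mp (h p' _ hp hq')⟩
      refine ⟨letter a w, ?_⟩
      simp only [eval, hw, ← h0]
      exact Fin.cons_self_tail f
    · cases d with
      | zero => exact p.elim0
      | succ d =>
        obtain ⟨q₀, hq₀, h₀⟩ := hf 0
        obtain rfl : q₀ = 0 := Fin.le_zero_iff.mp (h₀ p 0 (Fin.zero_le _) h0)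
        let g : Fin N → Option A ⊕ Fin d := fun i =>
          (f i.succ).elim (fun a => .inl (some a)) (Fin.cases (.inl none) .inr)
        have hg : ∀ i, shiftLetter (g i) = f i.succ := by
          intro i
          simp only [g]
          rcases f i.succ with a | j
          · rfl
          · cases j using Fin.cases <;> rfl
        obtain ⟨w, hw⟩ := ih g fun p => by
          obtain ⟨q, hq, h⟩ := hf p.succ
          cases q using Fin.cases with
          | zero => simp [hq₀, Fin.ext_iff] at hq
          | succ q =>
            refine ⟨q, by simp [g, hq], fun p' q' hp hq' => ?_⟩
            refine Fin.succ_le_succ_iff.mp (h p'.succ _ (Fin.succ_le_succ_iff.mpr hp) ?_)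
            rw [← hg, hq']
            rfl
        refine ⟨param w, ?_⟩
        simp only [eval, hw, hg, ← hq₀]
        exact Fin.cons_self_tail f

end PWord

/-- The Graham–Rothschild theorem for rigid maps with linearly ordered parameter sets. -/
theorem exists_isRigid_mono (P Q : Type) [Fintype P] [LinearOrder P] [Fintype Q] [LinearOrder Q]
    (K : Type) [Finite K] [Nonempty K] : ∃ N : ℕ, ∀ χ : (Fin N → Unit ⊕ P) → K,
      ∃ w : Fin N → Unit ⊕ Q, IsRigid w ∧ ∃ κ, ∀ f : Q → Unit ⊕ P, IsRigid f →
        χ (fun i => Sum.elim .inl f (w i)) = κ := by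
  let eP : Fin (Fintype.card P) ≃o P := Fintype.orderIsoFinOfCardEq P rfl
  let eQ : Fin (Fintype.card Q) ≃o Q := Fintype.orderIsoFinOfCardEq Q rfl
  obtain ⟨N, hN⟩ := PWord.exists_mono (Fintype.card P) Unit K (Fintype.card Q)
  refine ⟨N, fun χ => ?_⟩
  obtain ⟨w, κ, hw⟩ := hN fun u => χ fun i => (u.eval i).map id eP
  refine ⟨fun i => (w.eval i).map id eQ, fun q => ?_, κ, fun f hf => ?_⟩
  · obtain ⟨i, hi, h⟩ := w.isRigid_eval (eQ.symm q)
    refine ⟨i, by simp [hi], fun q' j hq hj => h (eQ.symm q') j (by simpa using hq) ?_⟩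
    rcases hwj : w.eval j with a | r
    · simp [hwj] at hj
    · simpa [hwj, OrderIso.eq_symm_apply] using hj
  · obtain ⟨u, hu⟩ := PWord.exists_eval_eq (fun i => (f (eQ i)).map id eP.symm) fun p => by
      obtain ⟨q, hq, h⟩ := hf (eP p)
      refine ⟨eQ.symm q, by simp [hq], fun p' q' hp hq' => ?_⟩
      refine eQ.symm_apply_le.mpr (h (eP p') (eQ q') (by simpa using hp) ?_)
      rcases hf' : f (eQ q') with a | r
      · simp [hf'] at hq'
      · simp only [hf', Sum.map_inr, Sum.inr.injEq] at hq'
        simp [← hq']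
    rw [← hw u]
    congr 1
    funext i
    simp only [PWord.comp, PWord.eval_subst, hu]
    rcases w.eval i with a | r
    · rfl
    · simp only [Sum.map_inr, Sum.elim_inr]
      rcases f (eQ r) with a | s <;> simp

/-- Indices for the blocks encoding an ordered graph on `Fin a`: one block for each vertex, followed
by one block for each pair of vertices. -/
inductive Block (a : ℕ) : Type
  | vert (i : Fin a) : Block a
  | pair (i j : Fin a) : Block a

namespace Block

/-- Sorting key: vertices precede pairs, and pairs are ordered lexicographically. -/
def key {a : ℕ} : Block a → ℕ ×ₗ ℕ ×ₗ ℕ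
  | vert i => toLex (0, toLex ((i : ℕ), 0))
  | pair i j => toLex (1, toLex ((i : ℕ), (j : ℕ)))

theorem key_injective {a : ℕ} : Function.Injective (key (a := a)) := by
  rintro (i | ⟨i, j⟩) (i' | ⟨i', j'⟩) h <;> simp_all [key, Fin.ext_iff]

noncomputable instance (a : ℕ) : LinearOrder (Block a) :=
  LinearOrder.lift' key key_injective

noncomputable instance (a : ℕ) : Fintype (Block a) :=
  Fintype.ofSurjective (Sum.elim vert fun q : Fin a × Fin a => pair q.1 q.2) <| by
    rintro (i | ⟨i, j⟩)
    · exact ⟨.inl i, rfl⟩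
    · exact ⟨.inr (i, j), rfl⟩

variable {a : ℕ} {i j i' j' : Fin a}

theorem vert_le_vert : vert i ≤ vert j ↔ i ≤ j := by
  change key _ ≤ key _ ↔ _
  simp only [key, Prod.Lex.toLex_le_toLex, lt_irrefl, false_or, true_and,
    le_refl, and_true, Fin.val_fin_lt]
  omega

theorem vert_le_pair : vert i ≤ pair i' j' := by
  change key _ ≤ key _
  simp [key, Prod.Lex.toLex_le_toLex]

theorem not_pair_le_vert : ¬ pair i j ≤ vert i' := by
  change ¬ key _ ≤ key _
  simp [key, Prod.Lex.toLex_le_toLex]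

theorem pair_le_pair : pair i j ≤ pair i' j' ↔ i < i' ∨ i = i' ∧ j ≤ j' := by
  change key _ ≤ key _ ↔ _
  simp [key, Prod.Lex.toLex_le_toLex, Fin.ext_iff]

end Block

/-- The block `q` is part of the set encoding the vertex `i` of `X`. -/
def Incident {a : ℕ} (X : SimpleGraph (Fin a)) (i : Fin a) : Block a → Prop
  | .vert j => i = j
  | .pair j l => X.Adj j l ∧ (i = j ∨ i = l)

/-- Vertices of the Ramsey graph: a subset of `Fin N`, where `false` marks the elements, together
with a color. -/
abbrev CodeVertex (N n : ℕ) : Type := (Lex (Fin N → Bool)) ×ₗ Fin n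

/-- Two vertices are adjacent if their colors differ and their sets meet. -/
def codeGraph (N n : ℕ) : SimpleGraph (CodeVertex N n) where
  Adj u v := (ofLex u).2 ≠ (ofLex v).2 ∧
    ∃ t, ofLex (ofLex u).1 t = false ∧ ofLex (ofLex v).1 t = false
  symm := ⟨fun _ _ h => ⟨h.1.symm, h.2.imp fun _ ht => ht.symm⟩⟩
  loopless := ⟨fun _ h => h.1 rfl⟩

open Classical in
/-- The vertex of `codeGraph N n` that encodes the vertex `i` of `X` using the blocks of `w`. -/
noncomputable def code {a n N : ℕ} (X : SimpleGraph (Fin a)) (lam : Fin a → Fin n)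
    (w : Fin N → Unit ⊕ Block a) (i : Fin a) : CodeVertex N n :=
  toLex (toLex fun t => decide (¬ ∃ q, w t = .inr q ∧ Incident X i q), lam i)

section code

variable {a n N : ℕ} (X : SimpleGraph (Fin a)) (lam : Fin a → Fin n) (w : Fin N → Unit ⊕ Block a)

theorem code_apply_eq_false {i : Fin a} {t : Fin N} :
    ofLex (ofLex (code X lam w i)).1 t = false ↔ ∃ q, w t = .inr q ∧ Incident X i q := by
  simp [code]

variable {X lam w}

theorem code_strictMono (hw : IsRigid w) : StrictMono (code X lam w) := by
  intro i j hij
  obtain ⟨t, ht, hmin⟩ := hw (.vert i)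
  refine Prod.Lex.toLex_lt_toLex.mpr (Or.inl ⟨t, fun s hs => ?_, ?_⟩)
  · have key : ∀ l, i ≤ l → ¬ ∃ q, w s = .inr q ∧ Incident X l q := by
      rintro l hl ⟨q, hq, hinc⟩
      refine hs.not_ge (hmin q s ?_ hq)
      cases q with
      | vert m => exact Block.vert_le_vert.mpr (hl.trans_eq hinc)
      | pair m m' => exact Block.vert_le_pair
    exact decide_eq_decide.mpr (iff_of_true (key i le_rfl) (key j hij.le))
  · have h₁ : ∃ q, w t = .inr q ∧ Incident X i q := ⟨_, ht, rfl⟩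
    have h₂ : ¬ ∃ q, w t = .inr q ∧ Incident X j q := by
      rintro ⟨q, hq, hinc⟩
      obtain rfl : Block.vert i = q := Sum.inr_injective (ht.symm.trans hq)
      exact hij.ne' hinc
    simp [h₁, h₂]

theorem code_adj (hw : IsRigid w) (hlam : ProperCol X lam) (i j : Fin a) :
    (codeGraph N n).Adj (code X lam w i) (code X lam w j) ↔ X.Adj i j := by
  constructor
  · rintro ⟨hne, t, hi, hj⟩
    obtain ⟨q, hq, hiq⟩ := (code_apply_eq_false X lam w).mp hi
    obtain ⟨q', hq', hjq⟩ := (code_apply_eq_false X lam w).mp hj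
    obtain rfl : q = q' := Sum.inr_injective (hq.symm.trans hq')
    have hij : i ≠ j := by rintro rfl; exact hne rfl
    cases q with
    | vert m => exact absurd (Eq.trans hiq (Eq.symm hjq)) hij
    | pair m m' =>
      obtain ⟨hadj, rfl | rfl⟩ := hiq <;> obtain ⟨-, rfl | rfl⟩ := hjq
      · exact absurd rfl hij
      · exact hadj
      · exact hadj.symm
      · exact absurd rfl hij
  · intro h
    obtain ⟨t, ht, -⟩ := hw (.pair i j)
    exact ⟨hlam i j h, t, (code_apply_eq_false X lam w).mpr ⟨_, ht, h, .inl rfl⟩,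
      (code_apply_eq_false X lam w).mpr ⟨_, ht, h, .inr rfl⟩⟩

end code

open Classical in
/-- The rigid map on blocks induced by an embedding `f` of ordered graphs: a pair with exactly one
vertex in the range of `f` is merged into the block of that vertex if it is an edge. -/
noncomputable def blockMap {a b : ℕ} (Y : SimpleGraph (Fin b)) (f : Fin a → Fin b) :
    Block b → Unit ⊕ Block a
  | .vert x => (Function.partialInv f x).elim (.inl ()) fun i => .inr (.vert i)
  | .pair x y =>
    match Function.partialInv f x, Function.partialInv f y with
    | some i, some j => .inr (.pair i j)
    | some i, none => if Y.Adj x y then .inr (.vert i) else .inl ()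
    | none, some j => if Y.Adj x y then .inr (.vert j) else .inl ()
    | none, none => .inl ()

section blockMap

variable {a b : ℕ} {X : SimpleGraph (Fin a)} {Y : SimpleGraph (Fin b)} {f : Fin a → Fin b}

theorem isRigid_blockMap (Y : SimpleGraph (Fin b)) (hf : StrictMono f) :
    IsRigid (blockMap Y f) := by
  have hinv := hf.injective.isPartialInv
  have hself : ∀ i, Function.partialInv f (f i) = some i := fun i => (hinv i (f i)).mpr rfl
  rintro (i | ⟨i, j⟩)
  · refine ⟨.vert (f i), by simp [blockMap, hself], ?_⟩
    rintro p' (x | ⟨x, y⟩) hp hx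
    · rcases h : Function.partialInv f x with _ | l
      · simp [blockMap, h] at hx
      · obtain rfl := (hinv l x).mp h
        simp only [blockMap, h, Option.elim_some, Sum.inr.injEq] at hx
        subst hx
        exact Block.vert_le_vert.mpr (hf.monotone (Block.vert_le_vert.mp hp))
    · exact Block.vert_le_pair
  · refine ⟨.pair (f i) (f j), by simp [blockMap, hself], ?_⟩
    rintro (l | ⟨l, m⟩) (x | ⟨x, y⟩) hp hx
    · exact absurd hp Block.not_pair_le_vert
    · exact absurd hp Block.not_pair_le_vert
    · rcases h : Function.partialInv f x with _ | l <;> simp [blockMap, h] at hx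
    · rcases h : Function.partialInv f x with _ | l' <;>
        rcases h' : Function.partialInv f y with _ | m' <;>
        simp only [blockMap, h, h'] at hx
      · simp at hx
      · split at hx <;> simp at hx
      · split at hx <;> simp at hx
      · obtain rfl := (hinv l' x).mp h
        obtain rfl := (hinv m' y).mp h'
        simp only [Sum.inr.injEq, Block.pair.injEq] at hx
        obtain ⟨rfl, rfl⟩ := hx
        rw [Block.pair_le_pair] at hp ⊢
        rw [hf.lt_iff_lt, hf.le_iff_le, hf.injective.eq_iff]
        exact hp

theorem incident_blockMap (hf : OrdEmb X Y f) (i : Fin a) (q : Block b) :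
    (∃ p, blockMap Y f q = .inr p ∧ Incident X i p) ↔ Incident Y (f i) q := by
  have hinj := hf.1.injective
  have hinv := hinj.isPartialInv
  have hnone : ∀ x, Function.partialInv f x = none → ∀ i, f i ≠ x := by
    intro x hx i hi
    simp [(hinv i x).mpr hi] at hx
  cases q with
  | vert x =>
    rcases h : Function.partialInv f x with _ | l
    · simp [blockMap, h, Incident, hnone x h]
    · obtain rfl := (hinv l x).mp h
      simp [blockMap, h, Incident, hinj.eq_iff]
  | pair x y =>
    rcases h : Function.partialInv f x with _ | l <;>
      rcases h' : Function.partialInv f y with _ | m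
    · simp [blockMap, h, h', Incident, hnone x h, hnone y h']
    · obtain rfl := (hinv m y).mp h'
      by_cases hadj : Y.Adj x (f m) <;>
        simp [blockMap, h, h', Incident, hnone x h, hinj.eq_iff, hadj]
    · obtain rfl := (hinv l x).mp h
      by_cases hadj : Y.Adj (f l) y <;>
        simp [blockMap, h, h', Incident, hnone y h', hinj.eq_iff, hadj]
    · obtain rfl := (hinv l x).mp h
      obtain rfl := (hinv m y).mp h'
      simp [blockMap, h, h', Incident, hinj.eq_iff, hf.2]

theorem code_blockMap {n N : ℕ} (hf : OrdEmb X Y f) (lam : Fin b → Fin n)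
    (w : Fin N → Unit ⊕ Block b) :
    code X (lam ∘ f) (fun t => Sum.elim .inl (blockMap Y f) (w t)) = code Y lam w ∘ f := by
  funext i
  simp only [code, Function.comp]
  congr 3
  funext t
  congr 2
  rcases w t with u | q
  · simp
  · simp [incident_blockMap hf i q]

end blockMap

/-- upper bound: for every `Y ∈ C^<_n` and `k` there is `Z ∈ C^<_n`
such that every `k`-coloring of copies of `X` in `Z` takes at most `σ(X)` values on
the copies of `X` in some copy of `Y`. -/
theorem stmt_4 (n : ℕ) (hn : 1 ≤ n) (a : ℕ)
    (X : SimpleGraph (Fin a)) (hX : X.Colorable n) :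
    ∀ (b : ℕ) (Y : SimpleGraph (Fin b)), Y.Colorable n →
      ∀ k : ℕ, ∃ (c : ℕ) (Z : SimpleGraph (Fin c)), Z.Colorable n ∧
        ∀ α : (Fin a → Fin c) → Fin k,
          ∃ e : Fin b → Fin c, OrdEmb Y Z e ∧
            ∃ V : Finset (Fin k),
              V.card ≤ Nat.card {lam : Fin a → Fin n // ProperCol X lam} ∧
              ∀ f : Fin a → Fin b, OrdEmb X Y f → α (e ∘ f) ∈ V := by
  classical
  rintro b Y ⟨C⟩ k
  rcases Nat.eq_zero_or_pos k with rfl | hk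
  · exact ⟨1, ⊥, ⟨⟨fun _ => ⟨0, hn⟩, fun h => h.elim⟩⟩, fun α => (α fun _ => 0).elim0⟩
  have : Nonempty (Fin k) := ⟨⟨0, hk⟩⟩
  obtain ⟨N, hN⟩ := exists_isRigid_mono (Block a) (Block b) ((Fin a → Fin n) → Fin k)
  have : Fintype (CodeVertex N n) := Fintype.ofFinite _
  let φ : Fin (Fintype.card (CodeVertex N n)) ≃o CodeVertex N n :=
    Fintype.orderIsoFinOfCardEq _ rfl
  refine ⟨_, (codeGraph N n).comap φ, ⟨⟨fun v => (ofLex (φ v)).2, fun h => h.1⟩⟩, fun α => ?_⟩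
  obtain ⟨w, hw, κ, hκ⟩ := hN fun u lam => α (φ.symm ∘ code X lam u)
  have hC : ProperCol Y C := fun i j h => C.valid h
  refine ⟨φ.symm ∘ code Y C w, ⟨φ.symm.strictMono.comp (code_strictMono hw), fun i j => ?_⟩,
    (Finset.univ.filter (ProperCol X)).image κ, ?_, fun f hf => ?_⟩
  · simpa using code_adj hw hC i j
  · rw [Nat.card_eq_fintype_card, Fintype.card_subtype]
    exact Finset.card_image_le
  · refine Finset.mem_image.mpr ⟨C ∘ f, ?_, ?_⟩
    · exact Finset.mem_filter.mpr
        ⟨Finset.mem_univ _, fun i j h => hC _ _ ((hf.2 i j).mpr h)⟩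
    · rw [← hκ _ (isRigid_blockMap Y hf.1)]
      simp only [code_blockMap hf]
      rfl
end

section
/- Fix an integer n ≥ 1 and let X be an element of the class C^<_n of all finite ordered n-colorable graphs. Then there exists Z ∈ C^<_n such that for every T ∈ C^<_n there is a map α from the copies of X in T to {1,…,σ(X)} with the property that for every copy Z̃ of Z in T, the map α attains all σ(X) values on the copies of X in Z̃. Consequently the Ramsey degree of X in C^<_n is at least σ(X). -/
/-- The set of valid Ramsey degrees of an ordered graph `X` in `C^<_n`. -/
def OrdDegSet (n a : ℕ) (X : SimpleGraph (Fin a)) : Set ℕ :=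
  {t | ∀ (b : ℕ) (Y : SimpleGraph (Fin b)), Y.Colorable n →
    ∀ k : ℕ, ∃ (c : ℕ) (Z : SimpleGraph (Fin c)), Z.Colorable n ∧
      ∀ α : (Fin a → Fin c) → Fin k,
        ∃ e : Fin b → Fin c, OrdEmb Y Z e ∧
          ∃ V : Finset (Fin k), V.card ≤ t ∧
            ∀ f : Fin a → Fin b, OrdEmb X Y f → α (e ∘ f) ∈ V}

/-- The disjoint union of copies of `X` indexed by `ι` together with an `n`-clique, where the vertex
`x` of the `i`-th copy is joined to every clique vertex other than `lam i x`. -/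
def cliqueExtension {ι : Type*} {n a : ℕ} (X : SimpleGraph (Fin a)) (lam : ι → Fin a → Fin n) :
    SimpleGraph (Fin n ⊕ ι × Fin a) where
  Adj
    | .inl i, .inl j => i ≠ j
    | .inl i, .inr p => i ≠ lam p.1 p.2
    | .inr p, .inl i => i ≠ lam p.1 p.2
    | .inr p, .inr q => p.1 = q.1 ∧ X.Adj p.2 q.2
  symm := ⟨by
    rintro (i | p) (j | q) h
    · exact Ne.symm h
    · exact h
    · exact h
    · exact ⟨h.1.symm, h.2.symm⟩⟩
  loopless := ⟨by
    rintro (i | p) h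
    · exact h rfl
    · exact X.irrefl h.2⟩

theorem cliqueExtension_colorable {ι : Type*} {n a : ℕ} (X : SimpleGraph (Fin a))
    (lam : ι → Fin a → Fin n) (hlam : ∀ i, ProperCol X (lam i)) :
    (cliqueExtension X lam).Colorable n := by
  refine ⟨SimpleGraph.Coloring.mk (Sum.elim id fun p => lam p.1 p.2) ?_⟩
  rintro (i | p) (j | q) h
  · exact h
  · exact h
  · exact Ne.symm h
  · obtain ⟨i, x⟩ := p
    obtain ⟨j, y⟩ := q
    obtain ⟨rfl, h⟩ := h
    exact hlam _ x y h

/-- Every proper `n`-coloring of `cliqueExtension X lam` arises from the standard one by permuting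
the colors. -/
theorem cliqueExtension_coloring_unique {ι : Type*} {n a : ℕ} (X : SimpleGraph (Fin a))
    (lam : ι → Fin a → Fin n) (C : (cliqueExtension X lam).Coloring (Fin n)) :
    ∃ π : Equiv.Perm (Fin n), ∀ i x, C (.inr (i, x)) = π (lam i x) := by
  have hinj : Function.Injective fun j => C (.inl j) := fun i j h => by
    by_contra hij
    exact C.valid (v := .inl i) (w := .inl j) hij h
  refine ⟨Equiv.ofBijective _ (Finite.injective_iff_bijective.mp hinj), fun i x => ?_⟩
  obtain ⟨j, hj⟩ := Finite.surjective_of_injective hinj (C (.inr (i, x)))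
  have hjx : j = lam i x := by
    by_contra hne
    exact C.valid (v := .inl j) (w := .inr (i, x)) hne hj
  rw [← hj, hjx]
  rfl

/-- For every ordered graph `X` there is an `n`-colorable ordered graph `Z` each of whose proper
`n`-colorings induces every proper `n`-coloring of `X` on some copy of `X`. -/
theorem exists_colorable_forall_coloring_realizes (n a : ℕ) (X : SimpleGraph (Fin a)) :
    ∃ (c : ℕ) (Z : SimpleGraph (Fin c)), Z.Colorable n ∧
      ∀ (C : Z.Coloring (Fin n)) (lam : Fin a → Fin n), ProperCol X lam →
        ∃ f : Fin a → Fin c, OrdEmb X Z f ∧ ∀ x, C (f x) = lam x := by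
  let E := Finite.equivFin {lam : Fin a → Fin n // ProperCol X lam}
  let lams := fun i => (E.symm i).1
  let q : Fin n ⊕ Fin (Nat.card {lam : Fin a → Fin n // ProperCol X lam}) × Fin a ≃ _ :=
    (Equiv.sumCongr (Equiv.refl (Fin n)) finProdFinEquiv).trans finSumFinEquiv
  let G := cliqueExtension X lams
  let φ : G ≃g G.comap q.symm := ⟨q, by simp⟩
  refine ⟨_, G.comap q.symm,
    (cliqueExtension_colorable X lams fun i => (E.symm i).2).of_hom φ.symm.toHom,
    fun C lam hlam => ?_⟩
  obtain ⟨π, hπ⟩ := cliqueExtension_coloring_unique X lams (C.comp φ.toHom)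
  let i := E ⟨π.symm ∘ lam, fun x y h => π.symm.injective.ne (hlam x y h)⟩
  refine ⟨fun x => q (.inr (i, x)), ⟨fun x y h => ?_, fun x y => ?_⟩, fun x => ?_⟩
  · change n + (x.val + a * i.val) < n + (y.val + a * i.val)
    gcongr
    exact h
  · simp [G, cliqueExtension]
  · refine (hπ i x).trans ?_
    simp [lams, i]

/-- lower bound: there is `Z ∈ C^<_n` such that every `T ∈ C^<_n`
admits a `σ(X)`-coloring of the copies of `X` attaining all `σ(X)` values on the
copies of `X` inside each copy of `Z`; hence the Ramsey degree of `X` in `C^<_n`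
is at least `σ(X)`. -/
theorem stmt_5 (n : ℕ) (hn : 1 ≤ n) (a : ℕ)
    (X : SimpleGraph (Fin a)) (hX : X.Colorable n) :
    (∃ (c : ℕ) (Z : SimpleGraph (Fin c)), Z.Colorable n ∧
      ∀ (d : ℕ) (T : SimpleGraph (Fin d)), T.Colorable n →
        ∃ α : (Fin a → Fin d) →
            Fin (Nat.card {lam : Fin a → Fin n // ProperCol X lam}),
          ∀ e : Fin c → Fin d, OrdEmb Z T e →
            ∀ v, ∃ f : Fin a → Fin c, OrdEmb X Z f ∧ α (e ∘ f) = v) ∧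
    ∀ t ∈ OrdDegSet n a X,
      Nat.card {lam : Fin a → Fin n // ProperCol X lam} ≤ t := by
  obtain ⟨c, Z, hZ, hreal⟩ := exists_colorable_forall_coloring_realizes n a X
  let E := Finite.equivFin {lam : Fin a → Fin n // ProperCol X lam}
  have hcol : ∀ (d : ℕ) (T : SimpleGraph (Fin d)), T.Colorable n →
      ∃ α : (Fin a → Fin d) → Fin (Nat.card {lam : Fin a → Fin n // ProperCol X lam}),
        ∀ e : Fin c → Fin d, OrdEmb Z T e →
          ∀ v, ∃ f : Fin a → Fin c, OrdEmb X Z f ∧ α (e ∘ f) = v := by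
    classical
    rintro d T ⟨C⟩
    obtain ⟨C₀⟩ := hX
    refine ⟨fun g => if h : ProperCol X (C ∘ g) then E ⟨C ∘ g, h⟩
      else E ⟨C₀, fun _ _ h => C₀.valid h⟩, fun e he v => ?_⟩
    obtain ⟨f, hf, hfv⟩ := hreal (C.comp ⟨e, (he.2 _ _).mpr⟩) (E.symm v).1 (E.symm v).2
    have heq : C ∘ e ∘ f = (E.symm v).1 := funext hfv
    refine ⟨f, hf, ?_⟩
    simp [heq, (E.symm v).2]
  refine ⟨⟨c, Z, hZ, hcol⟩, fun t ht => ?_⟩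
  obtain ⟨d, T, hT, hα⟩ := ht c Z hZ (Nat.card {lam : Fin a → Fin n // ProperCol X lam})
  obtain ⟨α, hattain⟩ := hcol d T hT
  obtain ⟨e, he, V, hV, hmem⟩ := hα α
  have huniv : V = Finset.univ := Finset.eq_univ_of_forall fun v => by
    obtain ⟨f, hf, rfl⟩ := hattain e he v
    exact hmem f hf
  simpa [huniv] using hV
end
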